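/- Let M be an o-minimal structure, A ⊆ M, and let S be an A-definable family of subsets of M^n. Then S extends to an A-definable n-type over M if and only if there exists an A-definable downward directed family of subsets of M^n that is finer than S. -/

import Mathlib

open FirstOrder Set

/-- `M` is an o-minimal `L`-structure: a densely linearly ordered structure without endpoints,
whose order is `∅`-definable, and in which every definable (with parameters) subset of `M`
is a finite union of points and open intervals with endpoints in `M ∪ {±∞}`. -/
def IsOMinimal (L : FirstOrder.Language) (M : Type*) [L.Structure M] [LinearOrder M] : Prop :=
  Nonempty M ∧ DenselyOrdered M ∧ NoMinOrder M ∧ NoMaxOrder M ∧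
  Set.Definable (∅ : Set M) L {v : Fin 2 → M | v 0 < v 1} ∧
  ∀ s : Set M, Set.Definable₁ (Set.univ : Set M) L s →
    ∃ F : Finset (Set M), s = ⋃₀ (F : Set (Set M)) ∧
      ∀ t ∈ F, (∃ a : M, t = {a}) ∨ (∃ a b : M, t = Set.Ioo a b) ∨
        (∃ a : M, t = Set.Ioi a) ∨ (∃ a : M, t = Set.Iio a) ∨ t = Set.univ

/-- The fiber over `u` of a set `D ⊆ M^{m+n}`, i.e. the set `φ(u, M^n)`. -/
def famFiber {M : Type*} {m n : ℕ} (D : Set (Fin m ⊕ Fin n → M)) (u : Fin m → M) :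
    Set (Fin n → M) :=
  {v | Sum.elim u v ∈ D}

/-- An `A`-definable family of subsets of `M^n`: the family of fibers `φ(u, M^n)` for `u`
ranging over an `A`-definable index set `Ω`, where `φ` is `A`-definable. -/
def IsDefFamily (L : FirstOrder.Language) {M : Type*} [L.Structure M] (A : Set M) (n : ℕ)
    (S : Set (Set (Fin n → M))) : Prop :=
  ∃ (m : ℕ) (Ω : Set (Fin m → M)) (D : Set (Fin m ⊕ Fin n → M)),
    Set.Definable A L Ω ∧ Set.Definable A L D ∧ S = famFiber D '' Ω

/-- A family of sets is downward directed: it does not contain `∅` and any two members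
contain a common member. -/
def DirectedFam {α : Type*} (S : Set (Set α)) : Prop :=
  ∅ ∉ S ∧ ∀ X ∈ S, ∀ Y ∈ S, ∃ Z ∈ S, Z ⊆ X ∩ Y

/-- `S` is finer than `F`: every member of `F` contains a member of `S`. -/
def FinerThan {α : Type*} (S F : Set (Set α)) : Prop :=
  ∀ X ∈ F, ∃ Y ∈ S, Y ⊆ X

/-- A (complete) `n`-type over `M`: an ultrafilter on the Boolean algebra of definable
subsets of `M^n`. -/
def IsTypeOn (L : FirstOrder.Language) {M : Type*} [L.Structure M] (n : ℕ)
    (p : Set (Set (Fin n → M))) : Prop :=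
  (∀ X ∈ p, Set.Definable (Set.univ : Set M) L X) ∧
  ∅ ∉ p ∧
  (∀ X ∈ p, ∀ Y ∈ p, X ∩ Y ∈ p) ∧
  (∀ X ∈ p, ∀ Y : Set (Fin n → M), Set.Definable (Set.univ : Set M) L Y → X ⊆ Y → Y ∈ p) ∧
  (∀ X : Set (Fin n → M), Set.Definable (Set.univ : Set M) L X → X ∈ p ∨ Xᶜ ∈ p)

/-- A type `p` is `A`-definable if for every `∅`-definable `D ⊆ M^{m+n}` the set of
parameters `u` with `φ(u, M^n) ∈ p` is `A`-definable. -/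
def IsDefTypeOver (L : FirstOrder.Language) {M : Type*} [L.Structure M] (A : Set M) (n : ℕ)
    (p : Set (Set (Fin n → M))) : Prop :=
  ∀ (m : ℕ) (D : Set (Fin m ⊕ Fin n → M)), Set.Definable (∅ : Set M) L D →
    Set.Definable A L {u : Fin m → M | famFiber D u ∈ p}

/-- A family `F` is complete for a family `X` if each member of `X` either contains a member
of `F` or is disjoint from one. -/
def CompleteFor {α : Type*} (F X : Set (Set α)) : Prop :=
  ∀ Y ∈ X, ∃ Z ∈ F, Z ⊆ Y ∨ Z ∩ Y = ∅

/-- A family of subsets of `M^n` is complete if it decides every definable set. -/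
def IsCompleteFam (L : FirstOrder.Language) {M : Type*} [L.Structure M] (n : ℕ)
    (S : Set (Set (Fin n → M))) : Prop :=
  ∀ X : Set (Fin n → M), Set.Definable (Set.univ : Set M) L X → ∃ Z ∈ S, Z ⊆ X ∨ Z ∩ X = ∅

/-- `B` is a basis for the type `p`: a downward directed subfamily generating `p`. -/
def IsBasisOfType {α : Type*} (B p : Set (Set α)) : Prop :=
  B ⊆ p ∧ DirectedFam B ∧ ∀ Y ∈ p, ∃ Z ∈ B, Z ⊆ Y

/-- `p` has an `A`-definable basis. -/
def HasDefBasis (L : FirstOrder.Language) {M : Type*} [L.Structure M] (A : Set M) (n : ℕ)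
    (p : Set (Set (Fin n → M))) : Prop :=
  ∃ B, IsDefFamily L A n B ∧ IsBasisOfType B p

/-- `S` has a finite tame transversal: it is covered by finitely many subfamilies, each of
which extends to a definable type. -/
def HasFTT (L : FirstOrder.Language) {M : Type*} [L.Structure M] (n : ℕ)
    (S : Set (Set (Fin n → M))) : Prop :=
  ∃ (N : ℕ) (p : Fin N → Set (Set (Fin n → M))),
    (∀ i, IsTypeOn L n (p i) ∧ IsDefTypeOver L (Set.univ : Set M) n (p i)) ∧
    ∀ X ∈ S, ∃ i, X ∈ p i

/-- The `(m,n)`-property: among any `m` members of the family, some `n` have nonempty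
intersection. -/
def HasMNProperty {α : Type*} (S : Set (Set α)) (m n : ℕ) : Prop :=
  ∀ F : Finset (Set α), ↑F ⊆ S → F.card = m →
    ∃ G ⊆ F, G.card = n ∧ (⋂₀ (G : Set (Set α))).Nonempty

universe u v w
set_option linter.unusedSectionVars false
set_option linter.unusedVariables false

/-- Types whose elements are coded by finite tuples from `M`. -/
class Coord (M : Type w) (X : Type*) where
  ι : Type
  fin : Finite ι
  e : X ≃ (ι → M)

/-- Types which can be codomains of definable maps. -/
class DTy (M : Type w) (Y : Type*) where
  κ : Type
  fin : Finite κ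
  emb : Y → Set (κ → M)

instance Coord.instFinite (M : Type w) (X : Type*) [Coord M X] : Finite (Coord.ι M X) := Coord.fin
instance DTy.instFinite (M : Type w) (X : Type*) [DTy M X] : Finite (DTy.κ M X) := DTy.fin

instance Coord.toDTy (M : Type w) (X : Type*) [Coord M X] : DTy M X where
  κ := Coord.ι M X
  fin := Coord.fin
  emb x := {Coord.e x}

instance DTy.prop (M : Type w) : DTy M Prop where
  κ := Empty
  fin := inferInstance
  emb p := {_v | p}

instance Coord.self (M : Type w) : Coord M M where
  ι := Unit
  fin := inferInstance
  e := (Equiv.funUnique Unit M).symm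

instance Coord.pi (M : Type w) (ι : Type) [Finite ι] : Coord M (ι → M) where
  ι := ι
  fin := inferInstance
  e := Equiv.refl _

instance Coord.prod (M : Type w) (X Y : Type*) [Coord M X] [Coord M Y] : Coord M (X × Y) where
  ι := Coord.ι M X ⊕ Coord.ι M Y
  fin := inferInstance
  e := (Equiv.prodCongr Coord.e Coord.e).trans (Equiv.sumArrowEquivProdArrow _ _ _).symm

instance Coord.unit (M : Type w) : Coord M PUnit where
  ι := Empty
  fin := inferInstance
  e := ⟨fun _ => Empty.elim, fun _ => ⟨⟩, fun _ => rfl, fun _ => by ext x; exact x.elim⟩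

section
variable (L : FirstOrder.Language.{u, v}) {M : Type w} [L.Structure M] (A : Set M)

/-- Definable maps. -/
@[fun_prop]
def DF {X Y : Type*} [Coord M X] [DTy M Y] (f : X → Y) : Prop :=
  A.Definable L {v : Coord.ι M X ⊕ DTy.κ M Y → M |
    v ∘ Sum.inr ∈ DTy.emb (f (Coord.e.symm (v ∘ Sum.inl)))}
end

section
variable {L : FirstOrder.Language.{u, v}} {M : Type w} [L.Structure M] {A : Set M}
variable {X Y Z : Type*} [Coord M X] [Coord M Y] [Coord M Z]

theorem DF.prop_iff {P : X → Prop} :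
    DF L A P ↔ A.Definable L {v : Coord.ι M X → M | P (Coord.e.symm v)} := by
  constructor
  · intro h
    have := Definable.preimage_comp (Sum.elim id Empty.elim : Coord.ι M X ⊕ Empty → Coord.ι M X) h
    exact this
  · intro h
    exact Definable.preimage_comp (Sum.inl : Coord.ι M X → Coord.ι M X ⊕ Empty) h

theorem DF.mono {Y : Type*} [DTy M Y] {B : Set M} {f : X → Y} (h : DF L A f) (hAB : A ⊆ B) : DF L B f :=
  Definable.mono h hAB

theorem definable_eq_coord {α : Type} (i j : α) : A.Definable L {v : α → M | v i = v j} := by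
  refine ⟨((FirstOrder.Language.var i).equal (FirstOrder.Language.var j)), ?_⟩
  ext x; simp

theorem DF.coordMap {f : X → Y} (σ : Coord.ι M Y → Coord.ι M X)
    (h : ∀ x, Coord.e (f x) = Coord.e x ∘ σ) : DF L A f := by
  have h1 : A.Definable L (⋂ i : Coord.ι M Y, {v : Coord.ι M X ⊕ Coord.ι M Y → M |
      v (Sum.inr i) = v (Sum.inl (σ i))}) :=
    definable_iInter_of_finite fun i => definable_eq_coord _ _
  unfold DF
  refine (congrArg (A.Definable L) (Set.ext fun v => ?_)).mp h1
  change _ ↔ v ∘ Sum.inr = Coord.e (f (Coord.e.symm (v ∘ Sum.inl)))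
  rw [h, Equiv.apply_symm_apply, mem_iInter, funext_iff]
  rfl

@[fun_prop]
theorem DF.id : DF L A (fun x : X => x) := DF.coordMap (fun i => i) fun _ => rfl

@[fun_prop]
theorem DF.comp {W : Type*} [DTy M W] {g : Y → W} {f : X → Y} (hg : DF L A g) (hf : DF L A f) :
    DF L A (fun x => g (f x)) := by
  have h1 := Definable.preimage_comp (Sum.elim (Sum.inl ∘ Sum.inl) Sum.inr :
    Coord.ι M X ⊕ Coord.ι M Y → (Coord.ι M X ⊕ DTy.κ M W) ⊕ Coord.ι M Y) hf
  have h2 := Definable.preimage_comp (Sum.elim Sum.inr (Sum.inl ∘ Sum.inr) :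
    Coord.ι M Y ⊕ DTy.κ M W → (Coord.ι M X ⊕ DTy.κ M W) ⊕ Coord.ι M Y) hg
  have := (h1.inter h2).exists_of_finite
  unfold DF
  convert this using 1
  ext v
  constructor
  · intro h
    refine ⟨Coord.e (f (Coord.e.symm (v ∘ Sum.inl))), ?_, ?_⟩
    · exact rfl
    · change v ∘ Sum.inr ∈ DTy.emb (g (Coord.e.symm (Coord.e (f (Coord.e.symm (v ∘ Sum.inl))))))
      rw [Equiv.symm_apply_apply]; exact h
  · rintro ⟨y, h1, h2⟩
    have h1' : y = Coord.e (f (Coord.e.symm (v ∘ Sum.inl))) := h1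
    have h2' : v ∘ Sum.inr ∈ DTy.emb (g (Coord.e.symm y)) := h2
    rw [h1', Equiv.symm_apply_apply] at h2'
    exact h2'

@[fun_prop]
theorem DF.fst : DF L A (fun x : X × Y => x.1) := DF.coordMap Sum.inl fun _ => rfl
@[fun_prop]
theorem DF.snd : DF L A (fun x : X × Y => x.2) := DF.coordMap Sum.inr fun _ => rfl
@[fun_prop]
theorem DF.apply {ι : Type} [Finite ι] (i : ι) : DF L A (fun x : ι → M => x i) :=
  DF.coordMap (fun _ => i) fun _ => rfl

@[fun_prop]
theorem DF.prodMk {f : X → Y} {g : X → Z} (hf : DF L A f) (hg : DF L A g) :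
    DF L A (fun x => (f x, g x)) := by
  have h1 := Definable.preimage_comp (Sum.map _root_.id Sum.inl :
    Coord.ι M X ⊕ Coord.ι M Y → Coord.ι M X ⊕ (Coord.ι M Y ⊕ Coord.ι M Z)) hf
  have h2 := Definable.preimage_comp (Sum.map _root_.id Sum.inr :
    Coord.ι M X ⊕ Coord.ι M Z → Coord.ι M X ⊕ (Coord.ι M Y ⊕ Coord.ι M Z)) hg
  unfold DF
  refine (congrArg (A.Definable L) (Set.ext fun v => ?_)).mp (h1.inter h2)
  symm
  constructor
  · intro h
    have h' : v ∘ Sum.inr = Coord.e (f (Coord.e.symm (v ∘ Sum.inl)), g (Coord.e.symm (v ∘ Sum.inl))) := h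
    refine ⟨?_, ?_⟩
    · exact congrArg (· ∘ Sum.inl) h'
    · exact congrArg (· ∘ Sum.inr) h'
  · rintro ⟨h1, h2⟩
    change v ∘ Sum.inr = Coord.e (f (Coord.e.symm (v ∘ Sum.inl)), g (Coord.e.symm (v ∘ Sum.inl)))
    have h1' : (v ∘ Sum.inr) ∘ Sum.inl = Coord.e (f (Coord.e.symm (v ∘ Sum.inl))) := h1
    have h2' : (v ∘ Sum.inr) ∘ Sum.inr = Coord.e (g (Coord.e.symm (v ∘ Sum.inl))) := h2
    funext i
    rcases i with i | i
    · exact congrFun h1' i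
    · exact congrFun h2' i

theorem DF.and {P Q : X → Prop} (hP : DF L A P) (hQ : DF L A Q) : DF L A (fun x => P x ∧ Q x) := by
  rw [DF.prop_iff] at *; exact hP.inter hQ
theorem DF.or {P Q : X → Prop} (hP : DF L A P) (hQ : DF L A Q) : DF L A (fun x => P x ∨ Q x) := by
  rw [DF.prop_iff] at *; exact hP.union hQ
theorem DF.not {P : X → Prop} (hP : DF L A P) : DF L A (fun x => ¬ P x) := by
  rw [DF.prop_iff] at *; exact hP.compl
theorem DF.imp {P Q : X → Prop} (hP : DF L A P) (hQ : DF L A Q) : DF L A (fun x => P x → Q x) := by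
  simp only [imp_iff_not_or]; exact hP.not.or hQ
theorem DF.iff {P Q : X → Prop} (hP : DF L A P) (hQ : DF L A Q) : DF L A (fun x => P x ↔ Q x) := by
  simp only [iff_iff_implies_and_implies]; exact (hP.imp hQ).and (hQ.imp hP)
theorem DF.constProp (p : Prop) : DF L A (fun _ : X => p) := by
  rw [DF.prop_iff]
  by_cases h : p
  · simp only [h]; exact definable_univ
  · simp only [h]; exact definable_empty

theorem DF.ex {P : X → Y → Prop} (h : DF L A (fun p : X × Y => P p.1 p.2)) :
    DF L A (fun x => ∃ y, P x y) := by
  rw [DF.prop_iff] at *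
  convert h.exists_of_finite using 1
  ext v
  constructor
  · rintro ⟨y, hy⟩
    refine ⟨Coord.e y, ?_⟩
    change P (Coord.e.symm v) (Coord.e.symm (Coord.e y))
    rwa [Equiv.symm_apply_apply]
  · rintro ⟨y, hy⟩
    exact ⟨Coord.e.symm y, hy⟩
theorem DF.all {P : X → Y → Prop} (h : DF L A (fun p : X × Y => P p.1 p.2)) :
    DF L A (fun x => ∀ y, P x y) := by
  have := (DF.ex (P := fun x y => ¬ P x y) h.not).not
  simpa using this

theorem DF.eq {f g : X → Y} (hf : DF L A f) (hg : DF L A g) : DF L A (fun x => f x = g x) := by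
  have : DF L A (fun p : Y × Y => p.1 = p.2) := by
    rw [DF.prop_iff]
    have : A.Definable L (⋂ i : Coord.ι M Y, {v : Coord.ι M Y ⊕ Coord.ι M Y → M |
      v (Sum.inl i) = v (Sum.inr i)}) := definable_iInter_of_finite fun i => definable_eq_coord _ _
    refine (congrArg (A.Definable L) (Set.ext fun v => ?_)).mp this
    symm
    simp only [mem_iInter]
    change Coord.e.symm (v ∘ Sum.inl) = Coord.e.symm (v ∘ Sum.inr) ↔ _
    rw [Equiv.apply_eq_iff_eq]
    exact funext_iff
  exact this.comp (hf.prodMk hg)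

attribute [fun_prop] DF.and DF.or DF.not DF.iff DF.eq DF.ex DF.constProp

attribute [fun_prop] DF.all DF.imp
end

/-- o-minimality as a class -/
class OMin (L : FirstOrder.Language.{u, v}) (M : Type w) [L.Structure M] [LinearOrder M] : Prop where
  h : IsOMinimal L M

section
variable {L : FirstOrder.Language.{u, v}} {M : Type w} [L.Structure M] {A : Set M}
variable {X Y Z : Type*} [Coord M X] [Coord M Y] [Coord M Z]

@[fun_prop]
theorem DF.const (c : Y) : DF L (Set.univ : Set M) (fun _ : X => c) := by
  have h1 : (Set.univ : Set M).Definable L (⋂ i : Coord.ι M Y, {v : Coord.ι M X ⊕ Coord.ι M Y → M |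
      v (Sum.inr i) = Coord.e c i}) := by
    refine definable_iInter_of_finite fun i => ?_
    refine ⟨((FirstOrder.Language.var (Sum.inr i)).equal
      (FirstOrder.Language.Constants.term
        ((L.con (⟨Coord.e c i, Set.mem_univ _⟩ : (Set.univ : Set M)))))), ?_⟩
    ext x; simp
  unfold DF
  refine (congrArg (Set.univ.Definable L) (Set.ext fun v => ?_)).mp h1
  change _ ↔ v ∘ Sum.inr = Coord.e c
  rw [mem_iInter, funext_iff]
  rfl

variable [LinearOrder M] [OMin L M]

@[fun_prop]
theorem DF.lt {f g : X → M} (hf : DF L A f) (hg : DF L A g) : DF L A (fun x => f x < g x) := by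
  have h := (OMin.h (L := L) (M := M)).2.2.2.2.1
  have h0 : DF L A (fun p : M × M => p.1 < p.2) := by
    rw [DF.prop_iff]
    have := (h.mono (Set.empty_subset A)).preimage_comp (![Sum.inl (), Sum.inr ()] : Fin 2 → Unit ⊕ Unit)
    exact this
  exact h0.comp (hf.prodMk hg)

@[fun_prop]
theorem DF.le {f g : X → M} (hf : DF L A f) (hg : DF L A g) : DF L A (fun x => f x ≤ g x) := by
  simp only [← not_lt]; exact (hg.lt hf).not


local notation "DU" => DF L (Set.univ : Set M)


theorem DF.omin {P : M → Prop} (h : DU P) : ∃ F : Finset (Set M), {x | P x} = ⋃₀ (F : Set (Set M)) ∧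
      ∀ t ∈ F, (∃ a : M, t = {a}) ∨ (∃ a b : M, t = Set.Ioo a b) ∨
        (∃ a : M, t = Set.Ioi a) ∨ (∃ a : M, t = Set.Iio a) ∨ t = Set.univ := by
  refine (OMin.h (L := L) (M := M)).2.2.2.2.2 _ ?_
  rw [DF.prop_iff] at h
  have := h.preimage_comp (fun _ : Unit => (0 : Fin 1))
  exact this

theorem DF.cut {P : M → Prop} (h : DU P) : ∃ F : Finset M, ∀ t t', t ≤ t' →
    (∀ z ∈ F, ¬ (t ≤ z ∧ z ≤ t')) → (P t ↔ P t') := by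
  classical
  obtain ⟨F, hF, hF'⟩ := h.omin
  have key : ∀ s ∈ F, ∃ G : Finset M, ∀ t t', t ≤ t' →
    (∀ z ∈ G, ¬ (t ≤ z ∧ z ≤ t')) → (t ∈ s ↔ t' ∈ s) := by
    intro s hs
    rcases hF' s hs with ⟨a, rfl⟩ | ⟨a, b, rfl⟩ | ⟨a, rfl⟩ | ⟨a, rfl⟩ | rfl
    · refine ⟨{a}, fun t t' htt hz => ?_⟩
      simp only [Finset.mem_singleton, forall_eq, mem_singleton_iff] at hz ⊢
      constructor
      · rintro rfl; exact absurd ⟨le_rfl, htt⟩ hz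
      · rintro rfl; exact absurd ⟨htt, le_rfl⟩ hz
    · refine ⟨{a, b}, fun t t' htt hz => ?_⟩
      simp only [Finset.mem_insert, Finset.mem_singleton, forall_eq_or_imp, forall_eq, mem_Ioo] at hz ⊢
      grind
    · refine ⟨{a}, fun t t' htt hz => ?_⟩
      simp only [Finset.mem_singleton, forall_eq, mem_Ioi] at hz ⊢
      grind
    · refine ⟨{a}, fun t t' htt hz => ?_⟩
      simp only [Finset.mem_singleton, forall_eq, mem_Iio] at hz ⊢
      grind
    · exact ⟨∅, fun t t' _ _ => by simp⟩
  choose! G hG using key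
  refine ⟨F.biUnion G, fun t t' htt hz => ?_⟩
  have e : ∀ x, P x ↔ ∃ s ∈ F, x ∈ s := fun x => by
    have : x ∈ {x | P x} ↔ x ∈ ⋃₀ (F : Set (Set M)) := by rw [hF]
    simpa using this
  rw [e, e]
  refine exists_congr fun s => and_congr_right fun hs => hG s hs t t' htt fun z hzG => hz z ?_
  exact Finset.mem_biUnion.2 ⟨s, hs, hzG⟩

/-- contains an interval -/
def Inf (P : M → Prop) : Prop := ∃ a b, a < b ∧ ∀ t, a < t → t < b → P t

/-- boundary -/
def bd (P : M → Prop) (t : M) : Prop :=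
  ¬ ∃ a b, a < t ∧ t < b ∧ ((∀ z, a < z → z < b → P z) ∨ (∀ z, a < z → z < b → ¬ P z))

variable (L) in
theorem DF.inf {P : X → M → Prop} (h : DF L A (fun p : X × M => P p.1 p.2)) :
    DF L A (fun x => Inf (P x)) := by unfold Inf; fun_prop
attribute [fun_prop] DF.inf
theorem DF.bd {P : X → M → Prop} {f : X → M} (h : DF L A (fun p : X × M => P p.1 p.2)) (hf : DF L A f) :
    DF L A (fun x => bd (P x) (f x)) := by unfold _root_.bd; fun_prop
attribute [fun_prop] DF.bd

theorem Inf.mono {P Q : M → Prop} (h : Inf P) (hPQ : ∀ t, P t → Q t) : Inf Q := by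
  obtain ⟨a, b, hab, h⟩ := h
  exact ⟨a, b, hab, fun t h1 h2 => hPQ _ (h t h1 h2)⟩

variable [DenselyOrdered M] [NoMinOrder M] [NoMaxOrder M] [Nonempty M]

theorem Inf.infinite {P : M → Prop} (h : Inf P) : {t | P t}.Infinite := by
  obtain ⟨a, b, hab, h⟩ := h
  exact (Set.Ioo_infinite hab).mono fun t ht => h t ht.1 ht.2

theorem DF.inf_iff {P : M → Prop} (h : DU P) : Inf P ↔ {t | P t}.Infinite := by
  refine ⟨Inf.infinite, fun hi => ?_⟩
  obtain ⟨F, hF, hF'⟩ := h.omin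
  by_contra hn
  apply hi
  rw [hF]
  refine F.finite_toSet.sUnion fun s hs => ?_
  have hsP : ∀ t ∈ s, P t := fun t ht => by
    have : t ∈ {x | P x} := by rw [hF]; exact ⟨s, hs, ht⟩
    exact this
  rcases hF' s hs with ⟨a, rfl⟩ | ⟨a, b, rfl⟩ | ⟨a, rfl⟩ | ⟨a, rfl⟩ | rfl
  · exact finite_singleton a
  · by_cases hab : a < b
    · exact absurd ⟨a, b, hab, fun t h1 h2 => hsP t ⟨h1, h2⟩⟩ hn
    · rw [Ioo_eq_empty hab]; exact finite_empty
  · obtain ⟨b, hb⟩ := exists_gt a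
    exact absurd ⟨a, b, hb, fun t h1 h2 => hsP t h1⟩ hn
  · obtain ⟨b, hb⟩ := exists_lt a
    exact absurd ⟨b, a, hb, fun t h1 h2 => hsP t h2⟩ hn
  · obtain ⟨a⟩ := ‹Nonempty M›
    obtain ⟨b, hb⟩ := exists_lt a
    exact absurd ⟨b, a, hb, fun t h1 h2 => hsP t trivial⟩ hn

theorem DF.fin_iff {P : M → Prop} (h : DU P) : {t | P t}.Finite ↔ ¬ Inf P := by
  rw [h.inf_iff, Set.not_infinite]

theorem exists_gap (F : Finset M) (t : M) : ∃ a b, a < t ∧ t < b ∧ ∀ z ∈ F, a < z → z < b → z = t := by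
  classical
  induction F using Finset.induction_on with
  | empty =>
    obtain ⟨a, ha⟩ := exists_lt t
    obtain ⟨b, hb⟩ := exists_gt t
    exact ⟨a, b, ha, hb, by simp⟩
  | insert z F hz ih =>
    obtain ⟨a, b, ha, hb, h⟩ := ih
    rcases lt_trichotomy z t with h1 | h1 | h1
    · refine ⟨max a z, b, max_lt ha h1, hb, ?_⟩
      intro y hy h2 h3
      rw [max_lt_iff] at h2
      rcases Finset.mem_insert.1 hy with rfl | hy
      · exact absurd h2.2 (lt_irrefl _)
      · exact h y hy h2.1 h3
    · refine ⟨a, b, ha, hb, ?_⟩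
      intro y hy h2 h3
      rcases Finset.mem_insert.1 hy with rfl | hy
      · exact h1
      · exact h y hy h2 h3
    · refine ⟨a, min b z, ha, lt_min hb h1, ?_⟩
      intro y hy h2 h3
      rw [lt_min_iff] at h3
      rcases Finset.mem_insert.1 hy with rfl | hy
      · exact absurd h3.2 (lt_irrefl _)
      · exact h y hy h2 h3.1

theorem DF.bd_finite {P : M → Prop} (h : DU P) : {t | _root_.bd P t}.Finite := by
  obtain ⟨F, hF⟩ := h.cut
  refine F.finite_toSet.subset fun t ht => ?_
  by_contra hn
  apply ht
  obtain ⟨a, b, ha, hb, hab⟩ := exists_gap F t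
  have : ∀ z, a < z → z < b → (P z ↔ P t) := by
    intro z h1 h2
    rcases le_total z t with h3 | h3
    · refine hF z t h3 ?_
      rintro y hy ⟨h4, h5⟩
      exact hn (hab y hy (h1.trans_le h4) (h5.trans_lt hb) ▸ hy)
    · refine (hF t z h3 ?_).symm
      rintro y hy ⟨h4, h5⟩
      exact hn (hab y hy (ha.trans_le h4) (h5.trans_lt h2) ▸ hy)
  by_cases hP : P t
  · exact ⟨a, b, ha, hb, Or.inl fun z h1 h2 => (this z h1 h2).2 hP⟩
  · exact ⟨a, b, ha, hb, Or.inr fun z h1 h2 => mt (this z h1 h2).1 hP⟩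

theorem not_bd {P : M → Prop} {t : M} (h : ¬ bd P t) :
    ∃ a b, a < t ∧ t < b ∧ ∀ z z', a < z → z < b → a < z' → z' < b → (P z ↔ P z') := by
  unfold bd at h
  push Not at h
  obtain ⟨a, b, ha, hb, h⟩ := h
  refine ⟨a, b, ha, hb, fun z z' h1 h2 h3 h4 => ?_⟩
  rcases h with h | h
  · exact iff_of_true (h z h1 h2) (h z' h3 h4)
  · exact iff_of_false (h z h1 h2) (h z' h3 h4)

theorem DF.const_of_not_bd {P : M → Prop} (h : DU P) : ∀ t t', t ≤ t' →
    (∀ z, t ≤ z → z ≤ t' → ¬ _root_.bd P z) → (P t ↔ P t') := by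
  classical
  obtain ⟨F, hF⟩ := h.cut
  have key : ∀ n, ∀ t t', t ≤ t' → (F.filter fun z => t ≤ z ∧ z ≤ t').card = n →
      (∀ z, t ≤ z → z ≤ t' → ¬ _root_.bd P z) → (P t ↔ P t') := by
    intro n
    induction n using Nat.strong_induction_on with
    | _ n ih =>
    intro t t' htt hn hb
    by_cases hne : ∃ z ∈ F, t ≤ z ∧ z ≤ t'
    · obtain ⟨z, hzF, h1, h2⟩ := hne
      obtain ⟨a, b, ha, hb', hab⟩ := not_bd (hb z h1 h2)
      have hz : z ∈ F.filter fun z => t ≤ z ∧ z ≤ t' := by simp [hzF, h1, h2]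
      trans P z
      · rcases h1.eq_or_lt with rfl | h1'
        · rfl
        obtain ⟨m, hm1, hm2⟩ := exists_between (max_lt ha h1')
        rw [max_lt_iff] at hm1
        rw [← hab m z hm1.1 (hm2.trans hb') ha hb']
        refine ih _ ?_ t m hm1.2.le rfl fun y h3 h4 => hb y h3 (h4.trans (hm2.le.trans h2))
        rw [← hn]
        refine Finset.card_lt_card (Finset.ssubset_iff_of_subset ?_ |>.2 ⟨z, hz, ?_⟩)
        · intro y; simp only [Finset.mem_filter]
          exact fun ⟨h3, h4, h5⟩ => ⟨h3, h4, h5.trans (hm2.le.trans h2)⟩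
        · simp [hm2]
      · rcases h2.eq_or_lt with rfl | h2'
        · rfl
        obtain ⟨m, hm2, hm1⟩ := exists_between (lt_min hb' h2')
        rw [lt_min_iff] at hm1
        rw [hab z m ha hb' (ha.trans hm2) hm1.1]
        refine ih _ ?_ m t' hm1.2.le rfl fun y h3 h4 => hb y (h1.trans (hm2.le.trans h3)) h4
        rw [← hn]
        refine Finset.card_lt_card (Finset.ssubset_iff_of_subset ?_ |>.2 ⟨z, hz, ?_⟩)
        · intro y; simp only [Finset.mem_filter]
          exact fun ⟨h3, h4, h5⟩ => ⟨h3, (h1.trans hm2.le).trans h4, h5⟩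
        · simp [hm2]
    · push Not at hne
      exact hF t t' htt fun z hz h => absurd (hne z hz h.1) (not_lt.2 h.2)
  exact fun t t' htt => key _ t t' htt rfl

/-- locally constant definable predicates are constant -/
theorem DF.loc_const {P : M → Prop} (h : DU P) {t t' : M} (htt : t ≤ t')
    (hl : ∀ z, t ≤ z → z ≤ t' → ∃ a b, a < z ∧ z < b ∧ ∀ y, a < y → y < b → (P y ↔ P z)) : P t ↔ P t' := by
  refine h.const_of_not_bd t t' htt fun z h1 h2 hb => hb ?_
  obtain ⟨a, b, ha, hb', hab⟩ := hl z h1 h2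
  by_cases hP : P z
  · exact ⟨a, b, ha, hb', Or.inl fun y h1 h2 => (hab y h1 h2).2 hP⟩
  · exact ⟨a, b, ha, hb', Or.inr fun y h1 h2 => mt (hab y h1 h2).1 hP⟩

theorem DF.glb {P : M → Prop} (h : DU P) (hne : ∃ t, P t) (hbd : ∃ b, ∀ t, P t → b ≤ t) :
    ∃ g, IsGLB {t | P t} g := by
  classical
  obtain ⟨F, hF, hF'⟩ := h.omin
  obtain ⟨b, hb⟩ := hbd
  have key : ∀ G : Finset (Set M), G ⊆ F → (⋃₀ (G : Set (Set M)) = ∅) ∨ ∃ g, IsGLB (⋃₀ (G : Set (Set M))) g := by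
    intro G
    induction G using Finset.induction_on with
    | empty => intro _; left; simp
    | insert s G hs ih =>
      intro hG
      rw [Finset.insert_subset_iff] at hG
      have h1 : s = ∅ ∨ ∃ g, IsGLB s g := by
        have hsP : ∀ t ∈ s, b ≤ t := fun t ht => by
          have : t ∈ {x | P x} := by rw [hF]; exact ⟨s, hG.1, ht⟩
          exact hb t this
        rcases hF' s hG.1 with ⟨a, rfl⟩ | ⟨a, c, rfl⟩ | ⟨a, rfl⟩ | ⟨a, rfl⟩ | rfl
        · right; exact ⟨a, isGLB_singleton⟩
        · by_cases hac : a < c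
          · right; exact ⟨a, isGLB_Ioo hac⟩
          · left; rw [Ioo_eq_empty hac]
        · right; exact ⟨a, isGLB_Ioi⟩
        · obtain ⟨d, hd⟩ := exists_lt (min a b)
          rw [lt_min_iff] at hd
          exact absurd (hsP d hd.1) (not_le.2 hd.2)
        · obtain ⟨d, hd⟩ := exists_lt b
          exact absurd (hsP d trivial) (not_le.2 hd)
      have h2 := ih hG.2
      rw [Finset.coe_insert, sUnion_insert]
      rcases h1 with h1 | ⟨g, h1⟩ <;> rcases h2 with h2 | ⟨g', h2⟩
      · left; simp [h1, h2]
      · right; rw [h1, empty_union]; exact ⟨g', h2⟩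
      · right; rw [h2, union_empty]; exact ⟨g, h1⟩
      · right; exact ⟨_, h1.union h2⟩
  rcases key F subset_rfl with h1 | h1
  · obtain ⟨t, ht⟩ := hne
    have : t ∈ {t | P t} := ht
    rw [hF, h1] at this; exact absurd this (by simp)
  · rw [hF]; exact h1

theorem DF.eventually {D Z : M → Prop} (hZ : DU Z) (hD : ∃ t, D t) :
    ∃ s, D s ∧ ((∀ t, D t → s ≤ t → Z t) ∨ (∀ t, D t → s ≤ t → ¬ Z t)) := by
  classical
  by_cases hmax : ∃ s, D s ∧ ∀ t, D t → t ≤ s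
  · obtain ⟨s, hs, hm⟩ := hmax
    refine ⟨s, hs, ?_⟩
    by_cases hz : Z s
    · left; intro t h1 h2; rwa [le_antisymm (hm t h1) h2]
    · right; intro t h1 h2; rwa [le_antisymm (hm t h1) h2]
  push Not at hmax
  obtain ⟨F, hF⟩ := hZ.cut
  have hex : ∃ n, ∃ s, D s ∧ (F.filter fun z => s ≤ z).card = n := by
    obtain ⟨t, ht⟩ := hD; exact ⟨_, t, ht, rfl⟩
  obtain ⟨s, hs, hn⟩ := Nat.find_spec hex
  have key : ∀ t, D t → s ≤ t → (Z s ↔ Z t) := by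
    intro t ht hst
    obtain ⟨t', ht', htt⟩ := hmax t ht
    refine hF s t hst fun z hz hzz => ?_
    have h1 : (F.filter fun z => t' ≤ z).card < Nat.find hex := by
      rw [← hn]
      refine Finset.card_lt_card (Finset.ssubset_iff_of_subset ?_ |>.2 ⟨z, ?_, ?_⟩)
      · intro y; simp only [Finset.mem_filter]
        exact fun ⟨h3, h4⟩ => ⟨h3, (hst.trans htt.le).trans h4⟩
      · simp [hz, hzz.1]
      · simp [hzz.2.trans_lt htt]
    exact Nat.find_min hex h1 ⟨t', ht', rfl⟩
  refine ⟨s, hs, ?_⟩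
  by_cases hz : Z s
  · left; intro t h1 h2; exact (key t h1 h2).1 hz
  · right; intro t h1 h2; exact mt (key t h1 h2).2 hz
end

section
variable {L : FirstOrder.Language.{u, v}} {M : Type w} [L.Structure M] {A : Set M}
variable {X Y Z : Type*} [Coord M X] [Coord M Y] [Coord M Z]
variable [LinearOrder M] [OMin L M]
variable [DenselyOrdered M] [NoMinOrder M] [NoMaxOrder M] [Nonempty M]

local notation "DU" => DF L (Set.univ : Set M)

theorem DF.K1 {P : M → M → Prop} (h : DU (fun p : M × M => P p.1 p.2))
    (hd : ∀ v v' x, P v x → P v' x → v = v') : ¬ Inf (fun v => Inf (P v)) := by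
  classical
  intro hI
  let W : M → Prop := fun x => ∃ v a b, a < x ∧ x < b ∧ ∀ z, a < z → z < b → P v z
  have hW : DU W := by fun_prop
  obtain ⟨F, hF⟩ := hW.cut
  have h1 : ∀ v, Inf (P v) → ∃ x, x ∉ F ∧ ∃ a b, a < x ∧ x < b ∧ ∀ z, a < z → z < b → P v z := by
    rintro v ⟨a, b, hab, h⟩
    obtain ⟨x, hx, hxF⟩ := ((Set.Ioo_infinite hab).sdiff F.finite_toSet).nonempty
    exact ⟨x, hxF, a, b, hx.1, hx.2, h⟩
  choose! x hxF hx using h1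
  obtain ⟨v, hv, v', hv', hne, he⟩ := hI.infinite.exists_ne_map_eq_of_mapsTo
    (f := fun v => F.filter (· < x v)) (t := (F.powerset : Set (Finset M)))
    (fun v _ => Finset.mem_coe.2 (Finset.mem_powerset.2 (Finset.filter_subset _ _)))
    (Finset.finite_toSet _)
  have key : ∀ v v', Inf (P v) → Inf (P v') → v ≠ v' →
      F.filter (· < x v) = F.filter (· < x v') → x v ≤ x v' → False := by
    intro v v' hv hv' hne he hle
    have hno : ∀ z ∈ F, ¬ (x v ≤ z ∧ z ≤ x v') := by
      rintro z hz ⟨h1, h2⟩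
      have h3 : z < x v' := lt_of_le_of_ne h2 fun h => hxF v' hv' (h ▸ hz)
      have h4 : z ∈ F.filter (· < x v') := by simp [hz, h3]
      rw [← he] at h4
      simp only [Finset.mem_filter] at h4
      exact absurd h4.2 (not_lt.2 h1)
    have hWv : W (x v) := ⟨v, hx v hv⟩
    have hWz : ∀ z, x v ≤ z → z ≤ x v' → W z := fun z h1 h2 =>
      (hF (x v) z h1 fun y hy hyy => hno y hy ⟨hyy.1, hyy.2.trans h2⟩).1 hWv
    have hQ : DU (fun z => P v z) := by fun_prop
    have hc := hQ.loc_const hle (fun z h1 h2 => by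
      obtain ⟨v'', a, b, ha, hb, h3⟩ := hWz z h1 h2
      refine ⟨a, b, ha, hb, fun y h4 h5 => ?_⟩
      constructor
      · intro h6; rw [hd v v'' y h6 (h3 y h4 h5)]; exact h3 z ha hb
      · intro h6; rw [hd v v'' z h6 (h3 z ha hb)]; exact h3 y h4 h5)
    obtain ⟨a, b, ha, hb, hab⟩ := hx v hv
    obtain ⟨a', b', ha', hb', hab'⟩ := hx v' hv'
    exact hne (hd v v' _ (hc.1 (hab _ ha hb)) (hab' _ ha' hb'))
  rcases le_total (x v) (x v') with hle | hle
  · exact key v v' hv hv' hne he hle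
  · exact key v' v hv' hv hne.symm he.symm hle

theorem exists_max_of_finite {P : M → Prop} (hf : {t | P t}.Finite) (hne : ∃ t, P t) :
    ∃ t, P t ∧ ∀ t', P t' → t' ≤ t := by
  obtain ⟨t, ht⟩ := hf.exists_maximal hne
  exact ⟨t, ht.1, fun t' h => by
    by_contra hlt
    exact hlt (ht.2 h (not_le.1 hlt).le)⟩

theorem exists_min_of_finite {P : M → Prop} (hf : {t | P t}.Finite) (hne : ∃ t, P t) :
    ∃ t, P t ∧ ∀ t', P t' → t ≤ t' := by
  obtain ⟨t, ht⟩ := hf.exists_minimal hne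
  exact ⟨t, ht.1, fun t' h => by
    by_contra hlt
    exact hlt (ht.2 h (not_le.1 hlt).le)⟩

theorem exists_gap' {P : M → Prop} (hf : {t | P t}.Finite) (t : M) :
    ∃ a b, a < t ∧ t < b ∧ ∀ z, P z → a < z → z < b → z = t := by
  obtain ⟨a, b, ha, hb, h⟩ := exists_gap hf.toFinset t
  exact ⟨a, b, ha, hb, fun z hz => h z (by simpa using hz)⟩

theorem DF.K {F : M → M → Prop} (h : DU (fun p : M × M => F p.1 p.2))
    (hfin : ∀ x, ¬ Inf (fun v => F v x)) : ¬ Inf (fun v => Inf (F v)) := by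
  rintro ⟨a, b, hab, hinf⟩
  let H : M → M → M → Prop := fun s v x => F v x ∧ ∀ v', s < v' → v' < v → ¬ F v' x
  have hH : DU (fun p : M × M × M => H p.1 p.2.1 p.2.2) := by fun_prop
  have hi : ∀ s, ¬ Inf (fun v => Inf (fun x => s < v ∧ H s v x)) := by
    intro s
    refine DF.K1 (L := L) (P := fun v x => s < v ∧ H s v x) (by fun_prop) ?_
    rintro v v' x ⟨h1, h2⟩ ⟨h3, h4⟩
    rcases lt_trichotomy v v' with h5 | h5 | h5
    · exact absurd h2.1 (h4.2 v h1 h5)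
    · exact h5
    · exact absurd h4.1 (h2.2 v' h3 h5)
  have hii : ∀ v, a < v → v < b → ∃ s, a < s ∧ s < v ∧ Inf (H s v) := by
    intro v hav hvb
    by_contra hno
    push Not at hno
    let J : M → Prop := fun x => F v x ∧ ∃ v', a < v' ∧ v' < v ∧ F v' x
    have hJ : {x | J x}.Infinite := by
      intro hJf
      obtain ⟨s, hs1, hs2⟩ := exists_between hav
      have h2 : {x | H s v x}.Finite := by
        rw [DF.fin_iff (L := L) (P := fun x => H s v x) (by fun_prop)]
        exact hno s hs1 hs2
      refine (hinf v hav hvb).infinite ((hJf.union h2).subset fun x hx => ?_)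
      by_cases hx' : J x
      · exact Or.inl hx'
      · exact Or.inr ⟨hx, fun v' h3 h4 h5 => hx' ⟨hx, v', hs1.trans h3, h4, h5⟩⟩
    let I : M → Prop := fun s => a < s ∧ s < v ∧ ∃ x, F s x ∧ H s v x
    have hI : Inf I := by
      by_contra hI
      rw [← DF.fin_iff (L := L) (P := I) (by fun_prop)] at hI
      obtain ⟨c, d, hc, hd, hcd⟩ := exists_gap' hI v
      obtain ⟨s, hs1, hs2⟩ := exists_between (max_lt hc hav)
      rw [max_lt_iff] at hs1
      have h2 : {x | H s v x}.Finite := by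
        rw [DF.fin_iff (L := L) (P := fun x => H s v x) (by fun_prop)]
        exact hno s hs1.2 hs2
      refine hJ (h2.subset ?_)
      rintro x ⟨hx, hx'⟩
      have h3 : {v' | a < v' ∧ v' < v ∧ F v' x}.Finite := by
        have : {v' | F v' x}.Finite := by
          rw [DF.fin_iff (L := L) (P := fun v' => F v' x) (by fun_prop)]
          exact hfin x
        exact this.subset fun y hy => hy.2.2
      obtain ⟨r, ⟨hr1, hr2, hr3⟩, hrm⟩ := exists_max_of_finite h3 hx'
      have hrI : I r := ⟨hr1, hr2, x, hr3, hx, fun v' h4 h5 h6 =>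
        absurd (hrm v' ⟨hr1.trans h4, h5, h6⟩) (not_le.2 h4)⟩
      have hrc : r ≤ c := by
        by_contra hrc
        exact absurd (hcd r hrI (not_le.1 hrc) (hr2.trans hd)) hr2.ne
      exact ⟨hx, fun v' h4 h5 h6 => absurd (hrm v' ⟨hs1.2.trans h4, h5, h6⟩)
        (not_le.2 ((hrc.trans_lt hs1.1).trans h4))⟩
    obtain ⟨c, d, hcd, hI⟩ := hI
    obtain ⟨s1, hs1, hs1'⟩ := exists_between hcd
    have h4 : ∀ s, c < s → s < s1 → ∃ x, F s x ∧ H s v x := fun s h1 h2 => (hI s h1 (h2.trans hs1')).2.2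
    choose! x hx1 hx2 using h4
    have h2 : {x | H s1 v x}.Finite := by
      rw [DF.fin_iff (L := L) (P := fun x => H s1 v x) (by fun_prop)]
      exact hno s1 (hI s1 hs1 hs1').1 (hI s1 hs1 hs1').2.1
    obtain ⟨s, hs, s', hs', hne, he⟩ := (Set.Ioo_infinite hs1).exists_ne_map_eq_of_mapsTo
      (f := x) (t := {x | H s1 v x}) (fun s hs => ⟨(hx2 s hs.1 hs.2).1,
        fun v' h1 h2 => (hx2 s hs.1 hs.2).2 v' (hs.2.trans h1) h2⟩) h2
    have key : ∀ s s', s ∈ Ioo c s1 → s' ∈ Ioo c s1 → x s = x s' → s < s' → False := by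
      intro s s' hs hs' he hlt
      refine (hx2 s hs.1 hs.2).2 s' hlt (hI s' hs'.1 (hs'.2.trans hs1')).2.1 ?_
      rw [he]; exact hx1 s' hs'.1 hs'.2
    rcases lt_or_gt_of_ne hne with hlt | hlt
    · exact key s s' hs hs' he hlt
    · exact key s' s hs' hs he.symm hlt
  let W : M → M → Prop := fun s v => a < s ∧ s < v ∧ v < b ∧ Inf (H s v)
  have hW : DU (fun p : M × M => W p.1 p.2) := by fun_prop
  have hWmono : ∀ s s' v, W s v → s ≤ s' → s' < v → W s' v := by
    rintro s s' v ⟨h1, h2, h3, h4⟩ h5 h6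
    exact ⟨h1.trans_le h5, h6, h3, h4.mono fun x hx => ⟨hx.1, fun v' h7 => hx.2 v' (h5.trans_lt h7)⟩⟩
  have hWfin : ∀ s, {v | W s v}.Finite := by
    intro s
    rw [DF.fin_iff (L := L) (P := fun v => W s v) (by fun_prop)]
    refine fun h1 => hi s (h1.mono fun v hv => hv.2.2.2.mono fun x hx => ⟨hv.2.1, hx⟩)
  let T : M → M → Prop := fun v x => W x v ∧ ∀ v', v < v' → ¬ W x v'
  have hT : DU (fun p : M × M => T p.1 p.2) := by fun_prop
  have hExc : ¬ Inf (fun v => Inf (T v)) := by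
    refine DF.K1 (L := L) (P := T) hT ?_
    intro v v' x h1 h2
    rcases lt_trichotomy v v' with h5 | h5 | h5
    · exact absurd h2.1 (h1.2 v' h5)
    · exact h5
    · exact absurd h1.1 (h2.2 v h5)
  rw [← DF.fin_iff (L := L) (by fun_prop)] at hExc
  obtain ⟨c, d, hc, hd, hcd⟩ := exists_gap' hExc b
  obtain ⟨v0, hv0, hv0b⟩ := exists_between (max_lt hc hab)
  rw [max_lt_iff] at hv0
  obtain ⟨s0, hs1, hs2, hs3⟩ := hii v0 hv0.2 hv0b
  obtain ⟨x0, hx1, hx2⟩ := exists_between hs2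
  have hW0 : ∀ x, s0 < x → x < x0 → W x v0 := fun x h1 h2 =>
    hWmono s0 x v0 ⟨hs1, hs2, hv0b, hs3⟩ h1.le (h2.trans hx2)
  have hfinal : (⋃ v ∈ {v | W x0 v ∧ v0 ≤ v}, {x | T v x}).Finite := by
    refine ((hWfin x0).subset fun v hv => hv.1).biUnion ?_
    rintro v ⟨hv1, hv2⟩
    rw [DF.fin_iff (L := L) (P := fun x => T v x) (by fun_prop)]
    intro hTi
    exact absurd (hcd v hTi (hv0.1.trans_le hv2) (hv1.2.2.1.trans hd)) hv1.2.2.1.ne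
  refine Set.Ioo_infinite hx1 (hfinal.subset ?_)
  rintro x ⟨h1, h2⟩
  obtain ⟨τ, hτ, hτm⟩ := exists_max_of_finite (hWfin x) ⟨v0, hW0 x h1 h2⟩
  have h3 := hτm v0 (hW0 x h1 h2)
  simp only [mem_iUnion, mem_ofPred_eq, exists_prop]
  exact ⟨τ, ⟨hWmono x x0 τ hτ h2.le (hx2.trans_le h3), h3⟩, hτ, fun v' h4 h5 =>
    absurd (hτm v' h5) (not_le.2 h4)⟩
end

section
variable {L : FirstOrder.Language.{u, v}} {M : Type w} [L.Structure M] {A : Set M}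

theorem coord_induct (S : ∀ (X : Type w) [Coord M X], Prop) (h0 : S PUnit)
    (h1 : ∀ (X : Type w) [Coord M X], S X → S (X × M))
    (htr : ∀ (X Y : Type w) [Coord M X] [Coord M Y] (f : X → Y) (g : Y → X),
      (∀ x, g (f x) = x) → (∀ y, f (g y) = y) → DF L (∅ : Set M) f → DF L (∅ : Set M) g → S X → S Y) :
    ∀ (X : Type w) [Coord M X], S X := by
  have hn : ∀ n : ℕ, S (Fin n → M) := by
    intro n
    induction n with
    | zero =>
      refine htr PUnit (Fin 0 → M) (fun _ => Fin.elim0) (fun _ => PUnit.unit) (fun _ => rfl)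
        (fun y => Subsingleton.elim _ _) ?_ ?_ h0
      · exact DF.coordMap (fun i : Fin 0 => i.elim0) fun x => by funext i; exact i.elim0
      · exact DF.coordMap (fun i : Empty => i.elim) fun x => by funext i; exact i.elim
    | succ n ih =>
      refine htr ((Fin n → M) × M) (Fin (n + 1) → M) (fun p => Fin.snoc (α := fun _ => M) p.1 p.2)
        (fun v => (fun i => v i.castSucc, v (Fin.last n))) ?_ ?_ ?_ ?_ (h1 _ ih)
      · rintro ⟨a, b⟩; simp
      · intro v; funext i
        refine Fin.lastCases ?_ (fun i => ?_) i <;> simp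
      · refine DF.coordMap (fun i : Fin (n + 1) => Fin.lastCases (motive := fun _ => Fin n ⊕ Unit)
          (Sum.inr ()) (fun i => Sum.inl i) i) fun x => ?_
        funext i
        change Fin.snoc (α := fun _ => M) x.1 x.2 i = _
        refine Fin.lastCases ?_ (fun i => ?_) i
        · simp; rfl
        · simp; rfl
      · exact DF.coordMap (fun i : Fin n ⊕ Unit => Sum.elim (fun i => i.castSucc) (fun _ => Fin.last n) i)
          fun x => by
            funext i
            rcases i with i | i <;> rfl
  intro X _
  obtain ⟨n, ⟨e⟩⟩ := Finite.exists_equiv_fin (Coord.ι M X)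
  refine htr (Fin n → M) X (fun v => Coord.e.symm (fun i => v (e i))) (fun x i => Coord.e x (e.symm i))
    ?_ ?_ ?_ ?_ (hn n)
  · intro x; simp
  · intro y; simp
  · exact DF.coordMap (fun i => e i) fun x => by simp; rfl
  · exact DF.coordMap (fun i : Fin n => e.symm i) fun x => rfl

variable {X Y Z : Type*} [Coord M X] [Coord M Y] [Coord M Z]
variable [LinearOrder M] [OMin L M]
variable [DenselyOrdered M] [NoMinOrder M] [NoMaxOrder M] [Nonempty M]

local notation "DU" => DF L (Set.univ : Set M)

theorem encard_succ_le (s : Set M) (n : ℕ) :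
    ((n + 1 : ℕ) : ℕ∞) ≤ s.encard ↔ ∃ y, y ∈ s ∧ (n : ℕ∞) ≤ {t | t ∈ s ∧ t < y}.encard := by
  classical
  constructor
  · intro h
    obtain ⟨t, hts, ht⟩ := Set.exists_subset_encard_eq h
    have htf : t.Finite := Set.finite_of_encard_eq_coe ht
    have hne : t.Nonempty := by
      rw [← Set.encard_ne_zero, ht]; simp
    obtain ⟨y, hy, hm⟩ := exists_max_of_finite (P := fun z => z ∈ t) htf hne
    refine ⟨y, hts hy, ?_⟩
    have h1 : t \ {y} ⊆ {z | z ∈ s ∧ z < y} := fun z hz => ⟨hts hz.1, lt_of_le_of_ne (hm z hz.1) hz.2⟩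
    refine le_trans ?_ (Set.encard_le_encard h1)
    have h2 := Set.encard_sdiff_singleton_add_one hy
    rw [ht] at h2
    push_cast at h2
    exact (ENat.add_left_injective_of_ne_top ENat.one_ne_top h2).ge
  · rintro ⟨y, hy, h⟩
    have h1 : insert y {t | t ∈ s ∧ t < y} ⊆ s := by
      intro z hz; rcases hz with rfl | hz
      · exact hy
      · exact hz.1
    refine le_trans ?_ (Set.encard_le_encard h1)
    rw [Set.encard_insert_of_notMem (by simp)]
    push_cast
    gcongr

theorem DF.card_ge (n : ℕ) {X : Type w} [Coord M X] {P : X → M → Prop} (h : DF L A (fun p : X × M => P p.1 p.2)) :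
    DF L A (fun x => (n : ℕ∞) ≤ {t | P x t}.encard) := by
  induction n generalizing X with
  | zero => simp only [Nat.cast_zero, zero_le]; fun_prop
  | succ n ih =>
    have : DF L A (fun p : X × M => (n : ℕ∞) ≤ {t | P p.1 t ∧ t < p.2}.encard) :=
      ih (X := X × M) (P := fun p t => P p.1 t ∧ t < p.2) (by fun_prop)
    simp only [encard_succ_le]
    exact DF.ex (P := fun x y => P x y ∧ (n : ℕ∞) ≤ {t | P x t ∧ t < y}.encard) (h.and this)

theorem DF.card_eq (n : ℕ) {X : Type w} [Coord M X] {P : X → M → Prop} (h : DF L A (fun p : X × M => P p.1 p.2)) :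
    DF L A (fun x => {t | P x t}.encard = n) := by
  have h1 := h.card_ge n
  have h2 := h.card_ge (n + 1)
  have : DF L A (fun x => (n : ℕ∞) ≤ {t | P x t}.encard ∧ ¬ ((n + 1 : ℕ) : ℕ∞) ≤ {t | P x t}.encard) := by
    fun_prop
  convert this using 2 with x
  rw [not_le]
  push_cast
  rw [ENat.lt_natCast_add_one_iff, and_comm, le_antisymm_iff]
attribute [fun_prop] DF.card_eq DF.card_ge

/-- holds near -/
def nb (v : M) (Q : M → Prop) : Prop := ∃ a b, a < v ∧ v < b ∧ ∀ z, a < z → z < b → Q z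

theorem DF.nb {Q : X → M → Prop} {f : X → M} (h : DF L A (fun p : X × M => Q p.1 p.2)) (hf : DF L A f) :
    DF L A (fun x => nb (f x) (Q x)) := by unfold _root_.nb; fun_prop
attribute [fun_prop] DF.nb

theorem nb.and {v : M} {P Q : M → Prop} (h : nb v P) (h' : nb v Q) : nb v (fun z => P z ∧ Q z) := by
  obtain ⟨a, b, ha, hb, h⟩ := h
  obtain ⟨a', b', ha', hb', h'⟩ := h'
  refine ⟨max a a', min b b', max_lt ha ha', lt_min hb hb', fun z h1 h2 => ?_⟩
  rw [max_lt_iff] at h1; rw [lt_min_iff] at h2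
  exact ⟨h z h1.1 h2.1, h' z h1.2 h2.2⟩

theorem nb.mono {v : M} {P Q : M → Prop} (h : nb v P) (hPQ : ∀ z, P z → Q z) : nb v Q := by
  obtain ⟨a, b, ha, hb, h⟩ := h
  exact ⟨a, b, ha, hb, fun z h1 h2 => hPQ z (h z h1 h2)⟩
theorem nb.self {v : M} {P : M → Prop} (h : nb v P) : P v := by
  obtain ⟨a, b, ha, hb, h⟩ := h
  exact h v ha hb
theorem nb.inf {v : M} {P : M → Prop} (h : nb v P) : Inf P := by
  obtain ⟨a, b, ha, hb, h⟩ := h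
  exact ⟨a, b, ha.trans hb, h⟩

variable (L) in
/-- thickness notions -/
structure Thick {Y : Type w} [Coord M Y] (th : (Y → Prop) → Prop) : Prop where
  df : ∀ {X : Type w} [Coord M X] (C : X → Y → Prop), DU (fun p : X × Y => C p.1 p.2) →
    DU (fun x => th (C x))
  ft : ∀ C : M → Y → Prop, DU (fun p : M × Y => C p.1 p.2) → Inf (fun v => th (C v)) →
    ∃ c, Inf (fun v => C v c)
  mono : ∀ C C' : Y → Prop, (∀ y, C y → C' y) → th C → th C'

theorem Thick.unit : Thick L (M := M) (fun C : PUnit.{w+1} → Prop => C ⟨⟩) where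
  df C h := by fun_prop
  ft C h hi := ⟨⟨⟩, hi⟩
  mono C C' h := h _

theorem Thick.prod {Y : Type w} [Coord M Y] {th : (Y → Prop) → Prop} (h : Thick L (M := M) th) :
    Thick L (M := M) (fun C : M × Y → Prop => Inf (fun x => th (fun y => C (x, y)))) where
  df {X} _ C hC := by
    have := h.df (X := X × M) (fun p y => C p.1 (p.2, y)) (by fun_prop)
    exact DF.inf L (P := fun x x1 => th (fun y => C x (x1, y))) this
  ft C hC hi := by
    have h1 := h.df (X := M × M) (fun p y => C p.1 (p.2, y)) (by fun_prop)
    have := DF.K (L := L) (F := fun v x => th (fun y => C v (x, y))) h1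
    have h2 : ∃ x, Inf (fun v => th (fun y => C v (x, y))) := by
      by_contra hno
      push Not at hno
      exact this hno hi
    obtain ⟨x, hx⟩ := h2
    obtain ⟨y, hy⟩ := h.ft (fun v y => C v (x, y)) (by fun_prop) hx
    exact ⟨(x, y), hy⟩
  mono C C' hc hi := hi.mono fun x hx => h.mono _ _ (fun y hy => hc _ hy) hx

theorem Thick.persist {Y : Type w} [Coord M Y] {th : (Y → Prop) → Prop} (h : Thick L (M := M) th)
    (R : M → Y → Prop) (hR : DU (fun p : M × Y => R p.1 p.2)) :
    ¬ Inf (fun v => th (fun c => R v c ∧ ¬ nb v (fun v' => R v' c))) := by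
  intro hi
  obtain ⟨c, a, b, hab, hc⟩ := h.ft (fun v c => R v c ∧ ¬ nb v (fun v' => R v' c)) (by fun_prop) hi
  obtain ⟨v, h1, h2⟩ := exists_between hab
  exact (hc v h1 h2).2 ⟨a, b, h1, h2, fun z h3 h4 => (hc z h3 h4).1⟩

theorem Thick.M1 : Thick L (M := M) (fun C : M → Prop => Inf C) where
  df C hC := by fun_prop
  ft C hC hi := by
    by_contra hno
    push Not at hno
    exact DF.K (L := L) (F := C) hC hno hi
  mono C C' hc hi := hi.mono hc

theorem Thick.M2 : Thick L (M := M) (fun C : M × M → Prop => Inf (fun x => Inf (fun y => C (x, y)))) :=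
  Thick.M1.prod

end

section
variable {L : FirstOrder.Language.{u, v}} {M : Type w} [L.Structure M] {A : Set M}
variable {X Y Z : Type*} [Coord M X] [Coord M Y] [Coord M Z]
variable [LinearOrder M] [OMin L M]
variable [DenselyOrdered M] [NoMinOrder M] [NoMaxOrder M] [Nonempty M]

local notation "DU" => DF L (Set.univ : Set M)

/-- empty on a closed interval -/
def emp (P : M → Prop) (x1 x2 : M) : Prop := ∀ y, x1 ≤ y → y ≤ x2 → ¬ P y
/-- exactly one element in a closed interval -/
def unq (P : M → Prop) (x1 x2 : M) : Prop :=
  ∃ y, x1 ≤ y ∧ y ≤ x2 ∧ P y ∧ ∀ y', x1 ≤ y' → y' ≤ x2 → P y' → y' = y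

theorem DF.emp {P : X → M → Prop} {f g : X → M} (h : DF L A (fun p : X × M => P p.1 p.2)) (hf : DF L A f)
    (hg : DF L A g) : DF L A (fun x => emp (P x) (f x) (g x)) := by unfold _root_.emp; fun_prop
theorem DF.unq {P : X → M → Prop} {f g : X → M} (h : DF L A (fun p : X × M => P p.1 p.2)) (hf : DF L A f)
    (hg : DF L A g) : DF L A (fun x => unq (P x) (f x) (g x)) := by unfold _root_.unq; fun_prop
attribute [fun_prop] DF.emp DF.unq

/-- good points -/
def Good (E : M → M → Prop) (v : M) : Prop :=
  (∀ x1 x2, x1 < x2 → emp (E v) x1 x2 → nb v (fun v' => emp (E v') x1 x2)) ∧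
  (∀ x, (∀ y, y ≤ x → ¬ E v y) → nb v (fun v' => ∀ y, y ≤ x → ¬ E v' y)) ∧
  (∀ x, (∀ y, x ≤ y → ¬ E v y) → nb v (fun v' => ∀ y, x ≤ y → ¬ E v' y)) ∧
  (∀ x1 y x2, x1 < y → y < x2 → E v y → (∀ y', x1 ≤ y' → y' ≤ x2 → E v y' → y' = y) →
    nb v (fun v' => unq (E v') x1 x2))

theorem DF.good {E : X → M → M → Prop} {f : X → M} (h : DF L A (fun p : X × M × M => E p.1 p.2.1 p.2.2))
    (hf : DF L A f) : DF L A (fun x => Good (E x) (f x)) := by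
  unfold Good
  fun_prop
attribute [fun_prop] DF.good

theorem bad_finite {E : M → M → Prop} (h : DU (fun p : M × M => E p.1 p.2))
    (hE : ∀ v, {y | E v y}.Finite) : {v | ¬ Good E v}.Finite := by
  let R2 : M → M × M → Prop := fun v c => c.1 < c.2 ∧ emp (E v) c.1 c.2
  let Rl : M → M → Prop := fun v x => ∀ y, y ≤ x → ¬ E v y
  let Rr : M → M → Prop := fun v x => ∀ y, x ≤ y → ¬ E v y
  let R1 : M → M × M → Prop := fun v c => c.1 < c.2 ∧ unq (E v) c.1 c.2
  have f2 : {v | Inf (fun x => Inf (fun y => R2 v (x, y) ∧ ¬ nb v (fun v' => R2 v' (x, y))))}.Finite := by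
    rw [DF.fin_iff (L := L) (by fun_prop)]
    exact Thick.M2.persist (L := L) R2 (by fun_prop)
  have f1 : {v | Inf (fun x => Inf (fun y => R1 v (x, y) ∧ ¬ nb v (fun v' => R1 v' (x, y))))}.Finite := by
    rw [DF.fin_iff (L := L) (by fun_prop)]
    exact Thick.M2.persist (L := L) R1 (by fun_prop)
  have fl : {v | Inf (fun y => Rl v y ∧ ¬ nb v (fun v' => Rl v' y))}.Finite := by
    rw [DF.fin_iff (L := L) (by fun_prop)]
    exact Thick.M1.persist (L := L) Rl (by fun_prop)
  have fr : {v | Inf (fun y => Rr v y ∧ ¬ nb v (fun v' => Rr v' y))}.Finite := by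
    rw [DF.fin_iff (L := L) (by fun_prop)]
    exact Thick.M1.persist (L := L) Rr (by fun_prop)
  refine (((f2.union f1).union fl).union fr).subset fun v hv => ?_
  by_contra hno
  simp only [mem_union, mem_ofPred_eq, not_or] at hno
  obtain ⟨⟨⟨n2, n1⟩, nl⟩, nr⟩ := hno
  apply hv
  have g2 : ∀ x1 x2, x1 < x2 → emp (E v) x1 x2 → nb v (fun v' => emp (E v') x1 x2) := by
    intro x1 x2 hx he
    by_contra hn
    apply n2
    obtain ⟨a, b, ha, hb, hab⟩ := exists_gap' (hE v) x1
    obtain ⟨c, d, hc, hd, hcd⟩ := exists_gap' (hE v) x2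
    refine ⟨a, x1, ha, fun y1 h1 h2 => ⟨x2, d, hd, fun y2 h3 h4 => ⟨⟨h2.trans (hx.trans h3), ?_⟩, ?_⟩⟩⟩
    · intro y h5 h6 h7
      by_cases h8 : y < x1
      · exact h8.ne (hab y h7 (h1.trans_le h5) (h8.trans hb))
      · by_cases h9 : x2 < y
        · exact h9.ne' (hcd y h7 (hc.trans h9) (h6.trans_lt h4))
        · exact he y (not_lt.1 h8) (not_lt.1 h9) h7
    · intro h5
      exact hn (h5.mono fun v' h6 y h7 h8 => h6.2 y (h2.le.trans h7) (h8.trans h3.le))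
  refine ⟨g2, ?_, ?_, ?_⟩
  · intro x hx
    by_contra hn
    apply nl
    obtain ⟨a, d, ha, hd, hcd⟩ := exists_gap' (hE v) x
    refine ⟨x, d, hd, fun z h1 h2 => ⟨?_, ?_⟩⟩
    · intro y h3 h4
      by_cases h5 : y ≤ x
      · exact hx y h5 h4
      · exact h5 (hcd y h4 (ha.trans (not_le.1 h5)) (h3.trans_lt h2)).le
    · intro h5
      exact hn (h5.mono fun v' h6 y h7 => h6 y (h7.trans h1.le))
  · intro x hx
    by_contra hn
    apply nr
    obtain ⟨a, d, ha, hd, hcd⟩ := exists_gap' (hE v) x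
    refine ⟨a, x, ha, fun z h1 h2 => ⟨?_, ?_⟩⟩
    · intro y h3 h4
      by_cases h5 : x ≤ y
      · exact hx y h5 h4
      · exact h5 (hcd y h4 (h1.trans_le h3) ((not_le.1 h5).trans hd)).ge
    · intro h5
      exact hn (h5.mono fun v' h6 y h7 => h6 y (h2.le.trans h7))
  · intro x1 y0 x2 hx1 hx2 hy hu
    by_contra hn
    apply n1
    obtain ⟨a, b, ha, hb, hab⟩ := exists_gap' (hE v) x1
    obtain ⟨c, d, hc, hd, hcd⟩ := exists_gap' (hE v) x2
    have e1 : ¬ E v x1 := fun h => hx1.ne (hu x1 le_rfl (hx1.trans hx2).le h)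
    have e2 : ¬ E v x2 := fun h => hx2.ne' (hu x2 (hx1.trans hx2).le le_rfl h)
    refine ⟨a, x1, ha, fun y1 h1 h2 => ⟨x2, d, hd, fun y2 h3 h4 =>
      ⟨⟨h2.trans ((hx1.trans hx2).trans h3), y0, (h2.trans hx1).le, (hx2.trans h3).le, hy, ?_⟩, ?_⟩⟩⟩
    · intro y h5 h6 h7
      by_cases h8 : y < x1
      · exact absurd (hab y h7 (h1.trans_le h5) (h8.trans hb)) h8.ne
      · by_cases h9 : x2 < y
        · exact absurd (hcd y h7 (hc.trans h9) (h6.trans_lt h4)) h9.ne'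
        · exact hu y (not_lt.1 h8) (not_lt.1 h9) h7
    · intro h5
      have h6 := g2 y1 x1 h2 (fun y h7 h8 h9 => by
        have := hab y h9 (h1.trans_le h7) (h8.trans_lt hb)
        exact e1 (this ▸ h9))
      have h7 := g2 x2 y2 h3 (fun y h7 h8 h9 => by
        have := hcd y h9 (hc.trans_le h7) (h8.trans_lt h4)
        exact e2 (this ▸ h9))
      refine hn (((h5.and h6).and h7).mono ?_)
      rintro v' ⟨⟨⟨-, y, k1, k2, k3, k4⟩, k5⟩, k6⟩
      refine ⟨y, ?_, ?_, k3, fun y' k7 k8 k9 => k4 y' (h2.le.trans k7) (k8.trans h3.le) k9⟩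
      · by_contra k; exact k5 y k1 (not_le.1 k).le k3
      · by_contra k; exact k6 y (not_le.1 k).le k2 k3

theorem good_count {E : M → M → Prop} {v : M} (hg : Good E v) (hE : {y | E v y}.Finite) (n : ℕ) :
    ∀ z, ¬ E v z → {y | E v y ∧ y < z}.encard = n → nb v (fun v' => {y | E v' y ∧ y < z}.encard = n) := by
  obtain ⟨g2, gl, gr, g1⟩ := hg
  induction n with
  | zero =>
    intro z hz h
    rw [Nat.cast_zero, Set.encard_eq_zero] at h
    refine (gl z fun y hy h' => ?_).mono fun v' h' => ?_
    · rcases hy.eq_or_lt with rfl | hy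
      · exact hz h'
      · have : y ∈ {y | E v y ∧ y < z} := ⟨h', hy⟩
        rw [h] at this; exact this
    · rw [Nat.cast_zero, Set.encard_eq_zero, Set.eq_empty_iff_forall_notMem]
      exact fun y hy => h' y hy.2.le hy.1
  | succ n ih =>
    intro z hz h
    have hne : ∃ y, E v y ∧ y < z := by
      have : {y | E v y ∧ y < z}.Nonempty := by
        rw [← Set.encard_ne_zero, h]; simp
      exact this
    obtain ⟨y, ⟨hy, hyz⟩, hm⟩ := exists_max_of_finite (hE.subset fun y hy => hy.1) hne
    obtain ⟨a, b, ha, hb, hab⟩ := exists_gap' hE y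
    obtain ⟨x1, h1, h1'⟩ := exists_between ha
    obtain ⟨x2, h2, h2'⟩ := exists_between (lt_min hb hyz)
    rw [lt_min_iff] at h2'
    have k1 : ¬ E v x1 := fun k => h1'.ne (hab x1 k h1 (h1'.trans hb))
    have k2 : {y | E v y ∧ y < x1}.encard = n := by
      have e : {y | E v y ∧ y < z} = insert y {y | E v y ∧ y < x1} := by
        ext t
        constructor
        · rintro ⟨k2, k3⟩
          by_cases k4 : t = y
          · exact Or.inl k4
          · right; refine ⟨k2, ?_⟩
            by_contra k5
            have := hm t ⟨k2, k3⟩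
            exact k4 (hab t k2 (h1.trans_le (not_lt.1 k5)) (this.trans_lt hb))
        · rintro (rfl | ⟨k2, k3⟩)
          · exact ⟨hy, hyz⟩
          · exact ⟨k2, k3.trans (h1'.trans hyz)⟩
      rw [e, Set.encard_insert_of_notMem (fun k => absurd k.2 (not_lt.2 h1'.le))] at h
      push_cast at h
      exact ENat.add_left_injective_of_ne_top ENat.one_ne_top h
    have q1 := ih x1 k1 k2
    have q2 := g1 x1 y x2 h1' h2 hy fun y' k3 k4 k5 => hab y' k5 (h1.trans_le k3) (k4.trans_lt h2'.1)
    have q3 := g2 x2 z h2'.2 (fun y' k3 k4 k5 => by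
      rcases k4.eq_or_lt with rfl | k4
      · exact hz k5
      · exact absurd (hm y' ⟨k5, k4⟩) (not_le.2 (h2.trans_le k3)))
    refine ((q1.and q2).and q3).mono ?_
    rintro v' ⟨⟨r1, y', r2, r3, r4, r5⟩, r6⟩
    have e : {y | E v' y ∧ y < z} = insert y' {y | E v' y ∧ y < x1} := by
      ext t
      constructor
      · rintro ⟨k2, k3⟩
        by_cases k4 : t < x1
        · exact Or.inr ⟨k2, k4⟩
        · left
          refine r5 t (not_lt.1 k4) ?_ k2
          by_contra k5
          exact r6 t (not_le.1 k5).le k3.le k2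
      · rintro (rfl | ⟨k2, k3⟩)
        · exact ⟨r4, r3.trans_lt h2'.2⟩
        · exact ⟨k2, k3.trans (h1'.trans hyz)⟩
    rw [e, Set.encard_insert_of_notMem (fun k => absurd k.2 (not_lt.2 r2)), r1]
    push_cast; rfl

theorem good_loc {E : M → M → Prop} {v : M} (hg : Good E v) (hE : {y | E v y}.Finite) :
    nb v (fun v' => {y | E v' y}.encard = {y | E v y}.encard) := by
  have hz : ∃ z, ∀ y, E v y → y < z := by
    by_cases hne : ∃ y, E v y
    · obtain ⟨y, hy, hm⟩ := exists_max_of_finite hE hne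
      obtain ⟨z, hz⟩ := exists_gt y
      exact ⟨z, fun y' h => (hm y' h).trans_lt hz⟩
    · obtain ⟨z⟩ := ‹Nonempty M›
      exact ⟨z, fun y h => absurd ⟨y, h⟩ hne⟩
  obtain ⟨z, hz⟩ := hz
  have q1 := hg.2.2.1 z fun y h1 h2 => absurd (hz y h2) (not_lt.2 h1)
  obtain ⟨n, hn⟩ : ∃ n : ℕ, {y | E v y}.encard = n := ⟨_, hE.encard_eq_coe⟩
  have e : {y | E v y ∧ y < z} = {y | E v y} := by
    ext t; exact ⟨fun h => h.1, fun h => ⟨h, hz t h⟩⟩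
  have q2 := good_count hg hE n z (fun h => lt_irrefl _ (hz z h)) (by rw [e, hn])
  refine (q1.and q2).mono ?_
  rintro v' ⟨r1, r2⟩
  rw [hn, ← r2]
  congr 1
  ext t
  exact ⟨fun h => ⟨h, by by_contra k; exact r1 t (not_lt.1 k) h⟩, fun h => h.1⟩
end

section
variable {L : FirstOrder.Language.{u, v}} {M : Type w} [L.Structure M] {A : Set M}
variable [LinearOrder M] [OMin L M]
variable [DenselyOrdered M] [NoMinOrder M] [NoMaxOrder M] [Nonempty M]

local notation "DU" => DF L (Set.univ : Set M)

/-- number of elements below -/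
noncomputable def cnt (P : M → Prop) (t : M) : ℕ∞ := {y | P y ∧ y < t}.encard

theorem cnt_mono {P : M → Prop} {t t' : M} (h : t ≤ t') : cnt P t ≤ cnt P t' :=
  Set.encard_le_encard fun y hy => ⟨hy.1, hy.2.trans_le h⟩

theorem cnt_lt {P : M → Prop} (hP : {y | P y}.Finite) {t z t' : M} (h1 : t ≤ z) (h2 : z < t') (hz : P z) :
    cnt P t < cnt P t' := by
  refine Set.Finite.encard_lt_encard (hP.subset fun y hy => hy.1) ?_
  have hsub : {y | P y ∧ y < t} ⊆ {y | P y ∧ y < t'} := fun y hy => ⟨hy.1, hy.2.trans_le (h1.trans h2.le)⟩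
  refine (Set.ssubset_iff_of_subset hsub).2 ⟨z, ⟨hz, h2⟩, ?_⟩
  exact fun h => absurd h.2 (not_lt.2 h1)

theorem cnt_inj {P : M → Prop} (hP : {y | P y}.Finite) {t t' : M} (h1 : P t) (h2 : P t') (h : cnt P t = cnt P t') :
    t = t' := by
  rcases lt_trichotomy t t' with h3 | h3 | h3
  · exact absurd h (cnt_lt hP le_rfl h3 h1).ne
  · exact h3
  · exact absurd h (cnt_lt hP le_rfl h3 h2).ne'

theorem cnt_between {P : M → Prop} (hP : {y | P y}.Finite) {t t' : M} (h2 : ¬ P t')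
    (h : cnt P t = cnt P t') (z : M) (h3 : t ≤ z) (h4 : z ≤ t') : ¬ P z := by
  intro hz
  rcases h4.eq_or_lt with rfl | h4
  · exact h2 hz
  · exact absurd h (cnt_lt hP h3 h4 hz).ne

theorem DF.cnt_eq {X : Type w} [Coord M X] {P : X → M → Prop} {f : X → M} (n : ℕ)
    (h : DF L A (fun p : X × M => P p.1 p.2)) (hf : DF L A f) : DF L A (fun x => cnt (P x) (f x) = n) := by
  unfold cnt
  exact DF.card_eq (P := fun x y => P x y ∧ y < f x) n (by fun_prop)
attribute [fun_prop] DF.cnt_eq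

theorem cnt_near {P : M → Prop} (hP : {y | P y}.Finite) {t : M} (ht : ¬ P t) :
    nb t (fun z => ¬ P z ∧ cnt P z = cnt P t) := by
  obtain ⟨a, b, ha, hb, hab⟩ := exists_gap' hP t
  have key : ∀ z, a < z → z < b → ¬ P z := fun z h1 h2 h3 => ht (hab z h3 h1 h2 ▸ h3)
  refine ⟨a, b, ha, hb, fun z h1 h2 => ⟨key z h1 h2, ?_⟩⟩
  unfold cnt
  congr 1
  ext y
  constructor
  · rintro ⟨h3, h4⟩
    refine ⟨h3, ?_⟩
    by_contra h5
    exact key y (ha.trans_le (not_lt.1 h5)) (h4.trans h2) h3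
  · rintro ⟨h3, h4⟩
    refine ⟨h3, ?_⟩
    by_contra h5
    exact key y (h1.trans_le (not_lt.1 h5)) (h4.trans hb) h3

variable (L) in
/-- the uniform finiteness statement -/
def UFS (X : Type w) [Coord M X] : Prop :=
  ∀ (Y : Type w) [Coord M Y] (th : (Y → Prop) → Prop) (_ : Thick L (M := M) th) (E : X → Y → M → Prop)
    (C : X → Y → Prop), DU (fun p : X × Y × M => E p.1 p.2.1 p.2.2) → DU (fun p : X × Y => C p.1 p.2) →
    (∀ a c, {t | E a c t}.Finite) →
    (∀ a c c', C a c → C a c' → {t | E a c t}.encard = {t | E a c' t}.encard) →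
    ∃ K : ℕ, ∀ a, th (C a) → ∀ c, C a c → {t | E a c t}.encard ≤ K

theorem UFS.uf0 {X : Type w} [Coord M X] (h : UFS L X (M := M)) {E : X → M → Prop}
    (hE : DU (fun p : X × M => E p.1 p.2)) (hf : ∀ x, {t | E x t}.Finite) :
    ∃ K : ℕ, ∀ x, {t | E x t}.encard ≤ K := by
  obtain ⟨K, hK⟩ := h PUnit _ Thick.unit (fun x _ t => E x t) (fun _ _ => True) (by fun_prop) (by fun_prop)
    (fun a _ => hf a) (fun _ _ _ _ _ => rfl)
  exact ⟨K, fun x => hK x trivial ⟨⟩ trivial⟩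

theorem bound_le (f : ℕ → ℕ) (K : ℕ) : ∃ N, ∀ i ≤ K, f i ≤ N :=
  ⟨(Finset.range (K + 1)).sup f, fun i hi => Finset.le_sup (f := f) (Finset.mem_range.2 (by omega))⟩

theorem UFS.step {X : Type w} [Coord M X] (h : UFS L X (M := M)) : UFS L (X × M) (M := M) := by
  intro Y _ th hth E C hE hC hfin hcon
  let Yw : X → M → Prop := fun w v => th (C (w, v))
  have hYw : DU (fun p : X × M => Yw p.1 p.2) := hth.df (X := X × M) (fun p => C (p.1, p.2)) (by fun_prop)
  let Bad : X → M → Prop := fun w v => Yw w v ∧ ¬ ∃ c, C (w, v) c ∧ nb v (fun v' => C (w, v') c) ∧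
    Good (fun v' y => E (w, v') c y) v
  have hBad : DU (fun p : X × M => Bad p.1 p.2) := by fun_prop
  let B : X → M → Prop := fun w v => Bad w v ∨ bd (Yw w) v
  have hB : DU (fun p : X × M => B p.1 p.2) := by fun_prop
  have hBfin : ∀ w, {v | B w v}.Finite := by
    intro w
    have h1 : {v | Bad w v}.Finite := by
      rw [DF.fin_iff (L := L) (by fun_prop)]
      rintro ⟨a, b, hab, hi⟩
      obtain ⟨c, a', b', hab', hc⟩ := hth.ft (fun v c => Bad w v ∧ C (w, v) c) (by fun_prop)
        ⟨a, b, hab, fun v h1 h2 => hth.mono _ _ (fun c hc => ⟨hi v h1 h2, hc⟩) (hi v h1 h2).1⟩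
      have h2 := bad_finite (L := L) (E := fun v' y => E (w, v') c y) (by fun_prop) (fun v => hfin (w, v) c)
      obtain ⟨v, hv, hvF⟩ := ((Set.Ioo_infinite hab').sdiff h2).nonempty
      refine (hc v hv.1 hv.2).1.2 ⟨c, (hc v hv.1 hv.2).2, ⟨a', b', hv.1, hv.2, fun z h3 h4 => (hc z h3 h4).2⟩, ?_⟩
      by_contra h5
      exact hvF h5
    have h2 : {v | bd (Yw w) v}.Finite := DF.bd_finite (L := L) (by fun_prop)
    exact (h1.union h2).subset fun v hv => hv
  obtain ⟨K0, hK0⟩ := h.uf0 hB hBfin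
  have hconst : ∀ w v v', v ≤ v' → (∀ z, v ≤ z → z ≤ v' → ¬ B w z) → ∀ c c', Yw w v → C (w, v) c → C (w, v') c' →
      {t | E (w, v) c t}.encard = {t | E (w, v') c' t}.encard := by
    intro w v v' hvv hno c c' hY hc hc'
    obtain ⟨n, hn⟩ : ∃ n : ℕ, {t | E (w, v) c t}.encard = n := ⟨_, (hfin (w, v) c).encard_eq_coe⟩
    let Q : M → Prop := fun z => ∃ c, C (w, z) c ∧ {t | E (w, z) c t}.encard = n
    have hQ : DU Q := by
      have := DF.card_eq (L := L) (A := univ) (X := M × Y) (P := fun p t => E (w, p.1) p.2 t) n (by fun_prop)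
      fun_prop
    have hYz : ∀ z, v ≤ z → z ≤ v' → Yw w z := fun z h1 h2 =>
      ((DF.const_of_not_bd (L := L) (P := Yw w) (by fun_prop)) v z h1
        (fun y h3 h4 h5 => hno y h3 (h4.trans h2) (Or.inr h5))).1 hY
    have hQc := hQ.loc_const hvv (fun z h1 h2 => by
      have h3 : ¬ Bad w z := fun h => hno z h1 h2 (Or.inl h)
      have h4 : ∃ c, C (w, z) c ∧ nb z (fun v' => C (w, v') c) ∧ Good (fun v' y => E (w, v') c y) z := by
        by_contra h5; exact h3 ⟨hYz z h1 h2, h5⟩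
      obtain ⟨d, hd, h5, h6⟩ := h4
      obtain ⟨a, b, ha, hb, hab⟩ := h5.and (good_loc h6 (hfin (w, z) d))
      refine ⟨a, b, ha, hb, fun y k1 k2 => ?_⟩
      obtain ⟨k3, k4⟩ := hab y k1 k2
      constructor
      · rintro ⟨e, he, he'⟩
        exact ⟨d, hd, by rw [← k4, hcon _ d e k3 he, he']⟩
      · rintro ⟨e, he, he'⟩
        exact ⟨d, k3, by rw [k4, hcon _ d e hd he, he']⟩)
    obtain ⟨e, he, he'⟩ := hQc.1 ⟨c, hc, hn⟩
    rw [hn, ← he', hcon _ e c' he hc']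
  have hcase1 : ∀ i : ℕ, ∃ K : ℕ, ∀ w v, ¬ B w v → cnt (B w) v = i → Yw w v → ∀ c, C (w, v) c →
      {t | E (w, v) c t}.encard ≤ K := by
    intro i
    obtain ⟨K, hK⟩ := h (M × Y) _ hth.prod (fun w p y => E (w, p.1) p.2 y)
      (fun w p => ¬ B w p.1 ∧ cnt (B w) p.1 = i ∧ Yw w p.1 ∧ C (w, p.1) p.2) (by fun_prop) (by fun_prop)
      (fun w p => hfin _ _) (by
        have key : ∀ w (p p' : M × Y), (¬ B w p.1 ∧ cnt (B w) p.1 = i ∧ Yw w p.1 ∧ C (w, p.1) p.2) →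
            (¬ B w p'.1 ∧ cnt (B w) p'.1 = i ∧ Yw w p'.1 ∧ C (w, p'.1) p'.2) → p.1 ≤ p'.1 →
            {t | E (w, p.1) p.2 t}.encard = {t | E (w, p'.1) p'.2 t}.encard := by
          rintro w p p' ⟨h1, h2, h3, h4⟩ ⟨h1', h2', h3', h4'⟩ hle
          exact hconst w p.1 p'.1 hle (cnt_between (hBfin w) h1' (h2.trans h2'.symm)) _ _ h3 h4 h4'
        intro w p p' h1 h2
        rcases le_total p.1 p'.1 with hle | hle
        · exact key w p p' h1 h2 hle
        · exact (key w p' p h2 h1 hle).symm)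
    refine ⟨K, fun w v h1 h2 h3 c hc => hK w ?_ (v, c) ⟨h1, h2, h3, hc⟩⟩
    obtain ⟨a, b, ha, hb, hab⟩ := not_bd (P := Yw w) (t := v) (fun h => h1 (Or.inr h))
    have hn : nb v (fun z => Yw w z) := ⟨a, b, ha, hb, fun z k1 k2 => (hab v z ha hb k1 k2).1 h3⟩
    refine ((hn.and (cnt_near (hBfin w) h1)).mono ?_).inf
    rintro z ⟨k1, k2, k3⟩
    exact hth.mono _ _ (fun c hc => ⟨k2, k3.trans h2, k1, hc⟩) k1
  have hcase2 : ∀ i : ℕ, ∃ K : ℕ, ∀ w v, B w v → cnt (B w) v = i → Yw w v → ∀ c, C (w, v) c →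
      {t | E (w, v) c t}.encard ≤ K := by
    intro i
    have huniq : ∀ w v, B w v → cnt (B w) v = i → ∀ c,
        {t | ∃ v, (B w v ∧ cnt (B w) v = i) ∧ E (w, v) c t} = {t | E (w, v) c t} := by
      intro w v h1 h2 c
      ext t
      constructor
      · rintro ⟨v', ⟨h3, h4⟩, h5⟩
        rw [cnt_inj (hBfin w) h1 h3 (h2.trans h4.symm)]; exact h5
      · intro h5; exact ⟨v, ⟨h1, h2⟩, h5⟩
    obtain ⟨K, hK⟩ := h Y _ hth (fun w c y => ∃ v, (B w v ∧ cnt (B w) v = i) ∧ E (w, v) c y)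
      (fun w c => ∃ v, (B w v ∧ cnt (B w) v = i) ∧ C (w, v) c) (by fun_prop) (by fun_prop)
      (fun w c => by
        by_cases hex : ∃ v, B w v ∧ cnt (B w) v = i
        · obtain ⟨v, h1, h2⟩ := hex
          rw [huniq w v h1 h2]; exact hfin _ _
        · refine finite_empty.subset ?_
          rintro t ⟨v, h1, h2⟩; exact hex ⟨v, h1⟩) (by
        rintro w c c' ⟨v, ⟨h1, h2⟩, h3⟩ ⟨v', ⟨h4, h5⟩, h6⟩
        rw [huniq w v h1 h2, huniq w v h1 h2]
        rw [← cnt_inj (hBfin w) h1 h4 (h2.trans h5.symm)] at h6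
        exact hcon _ _ _ h3 h6)
    refine ⟨K, fun w v h1 h2 h3 c hc => ?_⟩
    rw [← huniq w v h1 h2]
    exact hK w (hth.mono _ _ (fun c hc => ⟨v, ⟨h1, h2⟩, hc⟩) h3) c ⟨v, ⟨h1, h2⟩, hc⟩
  choose K1 hK1 using hcase1
  choose K2 hK2 using hcase2
  obtain ⟨N1, hN1⟩ := bound_le K1 K0
  obtain ⟨N2, hN2⟩ := bound_le K2 K0
  refine ⟨N1 + N2, ?_⟩
  rintro ⟨w, v⟩ ht c hc
  have hle : cnt (B w) v ≤ K0 := (Set.encard_le_encard fun y hy => hy.1).trans (hK0 w)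
  obtain ⟨i, hi⟩ : ∃ i : ℕ, cnt (B w) v = i := ⟨_, (ENat.natCast_toNat (ne_top_of_le_ne_top (by simp) hle)).symm⟩
  have hi' : i ≤ K0 := by rw [hi] at hle; exact_mod_cast hle
  by_cases hb : B w v
  · refine (hK2 i w v hb hi ht c hc).trans ?_
    have := hN2 i hi'
    exact_mod_cast (by omega : K2 i ≤ N1 + N2)
  · refine (hK1 i w v hb hi ht c hc).trans ?_
    have := hN1 i hi'
    exact_mod_cast (by omega : K1 i ≤ N1 + N2)

theorem UFS.all (X : Type w) [Coord M X] : UFS L X (M := M) := by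
  refine coord_induct (L := L) (M := M) (fun X _ => UFS L X (M := M)) ?_ ?_ ?_ X
  · intro Y _ th hth E C hE hC hfin hcon
    by_cases hne : ∃ c, C ⟨⟩ c
    · obtain ⟨c, hc⟩ := hne
      obtain ⟨n, hn⟩ : ∃ n : ℕ, {t | E ⟨⟩ c t}.encard = n := ⟨_, (hfin ⟨⟩ c).encard_eq_coe⟩
      exact ⟨n, fun a _ c' hc' => by rw [← hn, hcon ⟨⟩ c c' hc hc']⟩
    · exact ⟨0, fun a _ c' hc' => absurd ⟨c', hc'⟩ hne⟩
  · intro X _ h; exact h.step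
  · intro X X' _ _ f g hgf hfg hf hg h Y _ th hth E C hE hC hfin hcon
    have hf' : DU f := hf.mono (empty_subset _)
    obtain ⟨K, hK⟩ := h Y th hth (fun x => E (f x)) (fun x => C (f x)) (by fun_prop) (by fun_prop)
      (fun a => hfin _) (fun a => hcon _)
    refine ⟨K, fun a => ?_⟩
    have := hK (g a)
    simp only [hfg] at this
    exact this

theorem DF.uf {X : Type w} [Coord M X] {E : X → M → Prop}
    (hE : DU (fun p : X × M => E p.1 p.2)) (hf : ∀ x, {t | E x t}.Finite) :
    ∃ K : ℕ, ∀ x, {t | E x t}.encard ≤ K := (UFS.all X).uf0 hE hf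

/-- uniform bound on boundaries -/
theorem DF.ufbd {X : Type w} [Coord M X] {P : X → M → Prop}
    (hE : DU (fun p : X × M => P p.1 p.2)) :
    ∃ K : ℕ, ∀ x t, ∃ i : ℕ, i ≤ K ∧ cnt (_root_.bd (P x)) t = i := by
  obtain ⟨K, hK⟩ := DF.uf (L := L) (E := fun x t => _root_.bd (P x) t) (by fun_prop)
    (fun x => DF.bd_finite (L := L) (by fun_prop))
  refine ⟨K, fun x t => ?_⟩
  have hle : cnt (_root_.bd (P x)) t ≤ K := (Set.encard_le_encard fun y hy => hy.1).trans (hK x)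
  obtain ⟨i, hi⟩ : ∃ i : ℕ, cnt (_root_.bd (P x)) t = i :=
    ⟨_, (ENat.natCast_toNat (ne_top_of_le_ne_top (by simp) hle)).symm⟩
  exact ⟨i, by rw [hi] at hle; exact_mod_cast hle, hi⟩
end

section
variable {L : FirstOrder.Language.{u, v}} {M : Type w} [L.Structure M] {A : Set M}
variable [LinearOrder M] [OMin L M]
variable [DenselyOrdered M] [NoMinOrder M] [NoMaxOrder M] [Nonempty M]

local notation "DU" => DF L (Set.univ : Set M)

/-- the rank of a point with respect to a definable set -/
def rkEq (P : M → Prop) (j : ℕ) (t : M) : Prop :=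
  cnt (bd P) t = ((j / 2 : ℕ) : ℕ∞) ∧ (bd P t ↔ j % 2 = 1)

theorem DF.rkEq {X : Type w} [Coord M X] {P : X → M → Prop} {f : X → M} (j : ℕ)
    (h : DF L A (fun p : X × M => P p.1 p.2)) (hf : DF L A f) : DF L A (fun x => rkEq (P x) j (f x)) := by
  unfold _root_.rkEq
  have := DF.cnt_eq (P := fun x t => _root_.bd (P x) t) (j / 2) (by fun_prop) hf
  exact this.and (by fun_prop)
attribute [fun_prop] DF.rkEq

theorem rk_exists {X : Type w} [Coord M X] {P : X → M → Prop} (h : DU (fun p : X × M => P p.1 p.2)) :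
    ∃ K : ℕ, ∀ x t, ∃ j, j < K ∧ rkEq (P x) j t := by
  obtain ⟨K, hK⟩ := h.ufbd
  refine ⟨2 * K + 2, fun x t => ?_⟩
  obtain ⟨i, hi, hc⟩ := hK x t
  by_cases hb : bd (P x) t
  · exact ⟨2 * i + 1, by omega, by rw [hc]; congr 1; omega, by simp only [hb, true_iff]; omega⟩
  · exact ⟨2 * i, by omega, by rw [hc]; congr 1; omega, by simp only [hb, false_iff]; omega⟩

theorem rk_le {P : M → Prop} (h : DU P) {j j' : ℕ} {t t' : M} (h1 : rkEq P j t) (h2 : rkEq P j' t') (hle : t ≤ t') :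
    j ≤ j' := by
  rcases hle.eq_or_lt with rfl | hlt
  · have e1 : j / 2 = j' / 2 := by
      have := h1.1.symm.trans h2.1; exact_mod_cast this
    have e2 : (j % 2 = 1) ↔ (j' % 2 = 1) := h1.2.symm.trans h2.2
    omega
  · by_cases hb : bd P t
    · have := cnt_lt h.bd_finite le_rfl hlt hb
      rw [h1.1, h2.1] at this
      have e : j / 2 < j' / 2 := by exact_mod_cast this
      omega
    · have := cnt_mono (P := bd P) hle
      rw [h1.1, h2.1] at this
      have e : j / 2 ≤ j' / 2 := by exact_mod_cast this
      have : ¬ j % 2 = 1 := fun k => hb (h1.2.2 k)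
      omega

theorem rk_const {P : M → Prop} (h : DU P) {j : ℕ} {t t' : M} (h1 : rkEq P j t) (h2 : rkEq P j t') :
    P t ↔ P t' := by
  by_cases hb : j % 2 = 1
  · rw [cnt_inj h.bd_finite (h1.2.2 hb) (h2.2.2 hb) (h1.1.trans h2.1.symm)]
  · have b1 : ¬ bd P t := fun k => hb (h1.2.1 k)
    have b2 : ¬ bd P t' := fun k => hb (h2.2.1 k)
    rcases le_total t t' with hle | hle
    · exact h.const_of_not_bd _ _ hle (cnt_between h.bd_finite b2 (h1.1.trans h2.1.symm))
    · exact (h.const_of_not_bd _ _ hle (cnt_between h.bd_finite b1 (h2.1.trans h1.1.symm))).symm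

variable (L) in
/-- types on coordinate spaces -/
structure IsTy {X : Type w} [Coord M X] (p : (X → Prop) → Prop) : Prop where
  df : ∀ {P}, p P → DU P
  ne : ¬ p (fun _ => False)
  and : ∀ {P Q}, p P → p Q → p (fun x => P x ∧ Q x)
  mono : ∀ {P Q}, p P → DU Q → (∀ x, P x → Q x) → p Q
  tot : ∀ {P}, DU P → p P ∨ p (fun x => ¬ P x)

variable (L A) in
/-- definability of types -/
def DefTy {X : Type w} [Coord M X] (p : (X → Prop) → Prop) : Prop :=
  ∀ {U : Type w} [Coord M U] (D : U → X → Prop), DF L A (fun q : U × X => D q.1 q.2) → DF L A (fun u => p (D u))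

theorem IsTy.not {X : Type w} [Coord M X] {p : (X → Prop) → Prop} (hp : IsTy L p (M := M)) {P : X → Prop} (h1 : p P)
    (h2 : p (fun x => ¬ P x)) : False :=
  hp.ne (hp.mono (hp.and h1 h2) (by fun_prop) fun x hx => hx.2 hx.1)

theorem IsTy.exfin {X : Type w} [Coord M X] {p : (X → Prop) → Prop} (hp : IsTy L p (M := M)) {P : ℕ → X → Prop}
    (hP : ∀ i, DU (P i)) {Q : X → Prop} (hQ : p Q) (K : ℕ) (h : ∀ x, Q x → ∃ j, j < K ∧ P j x) :
    ∃ j, j < K ∧ p (P j) := by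
  induction K generalizing Q with
  | zero => exact absurd (hp.mono hQ (by fun_prop) fun x hx => by
      obtain ⟨j, hj, -⟩ := h x hx; omega) hp.ne
  | succ K ih =>
    rcases hp.tot (hP K) with h1 | h1
    · exact ⟨K, by omega, h1⟩
    · obtain ⟨j, hj, hpj⟩ := ih (hp.and hQ h1) (by
        rintro x ⟨hx, hx'⟩
        obtain ⟨j, hj, hj'⟩ := h x hx
        refine ⟨j, ?_, hj'⟩
        have : j ≠ K := by rintro rfl; exact hx' hj'
        omega)
      exact ⟨j, by omega, hpj⟩

variable (L A) in
/-- directed definable families -/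
structure Dir {X V : Type w} [Coord M X] [Coord M V] (Ω : V → Prop) (D : V → X → Prop) : Prop where
  dfΩ : DF L A Ω
  dfD : DF L A (fun q : V × X => D q.1 q.2)
  ne : ∃ v, Ω v
  dir : ∀ v v', Ω v → Ω v' → ∃ w, Ω w ∧ ∀ x, D w x → D v x ∧ D v' x

variable (L A) in
/-- there is a directed family inside `p` finer than `S` -/
def FwdC {X U : Type w} [Coord M X] [Coord M U] (p : (X → Prop) → Prop) (Ω : U → Prop) (S : U → X → Prop) : Prop :=
  ∃ (V : Type w) (_ : Coord M V) (Ω' : V → Prop) (D : V → X → Prop), Dir L A Ω' D ∧ (∀ v, Ω' v → p (D v)) ∧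
    ∀ u, Ω u → ∃ v, Ω' v ∧ ∀ x, D v x → S u x

variable (L) in
/-- forward statement -/
def Fwd (X : Type w) [Coord M X] : Prop :=
  ∀ (A : Set M) (p : (X → Prop) → Prop), IsTy L (M := M) p → DefTy L A p → ∀ (U : Type w) [Coord M U] (Ω : U → Prop)
    (S : U → X → Prop), DF L A Ω → DF L A (fun q : U × X => S q.1 q.2) → (∀ u, Ω u → p (S u)) → FwdC L A p Ω S

section
variable {X : Type w} [Coord M X] {p : (X → Prop) → Prop}

theorem IsTy.true (hp : IsTy L p (M := M)) : p (fun _ => True) := by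
  rcases hp.tot (P := fun _ => True) (by fun_prop) with h | h
  · exact h
  · exact hp.mono h (by fun_prop) fun _ _ => trivial

theorem FwdC.combine (hp : IsTy L p (M := M)) {U U' : Type w} [Coord M U] [Coord M U'] {Ω : U → Prop}
    {S : U → X → Prop} {Ω' : U' → Prop} {S' : U' → X → Prop} (h : FwdC L A p Ω S) (h' : FwdC L A p Ω' S')
    : ∃ (V : Type w) (_ : Coord M V) (Ω₁ : V → Prop) (D : V → X → Prop), Dir L A Ω₁ D ∧ (∀ v, Ω₁ v → p (D v)) ∧
    (∀ u, Ω u → ∃ v, Ω₁ v ∧ ∀ x, D v x → S u x) ∧ (∀ u, Ω' u → ∃ v, Ω₁ v ∧ ∀ x, D v x → S' u x) ∧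
    (∀ u u', Ω u → Ω' u' → ∃ v, Ω₁ v ∧ ∀ x, D v x → S u x ∧ S' u' x) := by
  obtain ⟨V, _, O1, D, hD, hm, hf⟩ := h
  obtain ⟨V', _, O1', D', hD', hm', hf'⟩ := h'
  have d1 := hD.dfΩ
  have d2 := hD.dfD
  have d3 := hD'.dfΩ
  have d4 := hD'.dfD
  obtain ⟨v0, hv0⟩ := hD.ne
  obtain ⟨v0', hv0'⟩ := hD'.ne
  refine ⟨V × V', inferInstance, fun v => O1 v.1 ∧ O1' v.2, fun v x => D v.1 x ∧ D' v.2 x,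
    ⟨by fun_prop, by fun_prop, ⟨(v0, v0'), hv0, hv0'⟩, ?_⟩, ?_, ?_, ?_, ?_⟩
  · rintro ⟨a, b⟩ ⟨a', b'⟩ ⟨h1, h2⟩ ⟨h3, h4⟩
    obtain ⟨c, hc, hc'⟩ := hD.dir a a' h1 h3
    obtain ⟨d, hd, hd'⟩ := hD'.dir b b' h2 h4
    exact ⟨(c, d), ⟨hc, hd⟩, fun x hx => ⟨⟨(hc' x hx.1).1, (hd' x hx.2).1⟩, ⟨(hc' x hx.1).2, (hd' x hx.2).2⟩⟩⟩
  · rintro ⟨a, b⟩ ⟨h1, h2⟩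
    exact hp.and (hm _ h1) (hm' _ h2)
  · intro u hu
    obtain ⟨v, hv, hvx⟩ := hf u hu
    exact ⟨(v, v0'), ⟨hv, hv0'⟩, fun x hx => hvx x hx.1⟩
  · intro u hu
    obtain ⟨v, hv, hvx⟩ := hf' u hu
    exact ⟨(v0, v), ⟨hv0, hv⟩, fun x hx => hvx x hx.2⟩
  · intro u u' hu hu'
    obtain ⟨v, hv, hvx⟩ := hf u hu
    obtain ⟨v', hv', hvx'⟩ := hf' u' hu'
    exact ⟨(v, v'), ⟨hv, hv'⟩, fun x hx => ⟨hvx x hx.1, hvx' x hx.2⟩⟩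

theorem FwdC.merge (hp : IsTy L p (M := M)) {U : Type w} [Coord M U] {Ω Ω' : U → Prop}
    {S : U → X → Prop} (h : FwdC L A p Ω S) (h' : FwdC L A p Ω' S) : FwdC L A p (fun u => Ω u ∨ Ω' u) S := by
  obtain ⟨V, i, O, D, h1, h2, h3, h4, -⟩ := h.combine hp h'
  exact ⟨V, i, O, D, h1, h2, fun u hu => hu.elim (h3 u) (h4 u)⟩

theorem FwdC.mono {U : Type w} [Coord M U] {Ω Ω' : U → Prop}
    {S S' : U → X → Prop} (h : FwdC L A p Ω S) (h' : ∀ u, Ω' u → Ω u) (h'' : ∀ u, Ω' u → ∀ x, S u x → S' u x) :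
    FwdC L A p Ω' S' := by
  obtain ⟨V, i, O, D, h1, h2, h3⟩ := h
  refine ⟨V, i, O, D, h1, h2, fun u hu => ?_⟩
  obtain ⟨v, hv, hvx⟩ := h3 u (h' u hu)
  exact ⟨v, hv, fun x hx => h'' u hu x (hvx x hx)⟩

theorem FwdC.triv (hp : IsTy L p (M := M)) {U : Type w} [Coord M U] {Ω : U → Prop}
    {S : U → X → Prop} (h : ∀ u, Ω u → ∀ x, S u x) : FwdC L A p Ω S :=
  ⟨PUnit, inferInstance, fun _ => True, fun _ _ => True, ⟨by fun_prop, by fun_prop, ⟨⟨⟩, trivial⟩,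
    fun _ _ _ _ => ⟨⟨⟩, trivial, fun _ _ => ⟨trivial, trivial⟩⟩⟩, fun _ _ => hp.true,
    fun u hu => ⟨⟨⟩, trivial, fun x _ => h u hu x⟩⟩

theorem FwdC.fin (hp : IsTy L p (M := M)) {U : Type w} [Coord M U] {Ω : ℕ → U → Prop}
    {S : U → X → Prop} (h : ∀ i, FwdC L A p (Ω i) S) (K : ℕ) : FwdC L A p (fun u => ∃ i, i < K ∧ Ω i u) S := by
  induction K with
  | zero => exact FwdC.triv hp fun u ⟨i, hi, _⟩ => by omega
  | succ K ih =>
    refine (ih.merge hp (h K)).mono ?_ fun _ _ _ h => h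
    rintro u ⟨i, hi, hu⟩
    rcases Nat.lt_succ_iff_lt_or_eq.1 hi with h1 | rfl
    · exact Or.inl ⟨i, h1, hu⟩
    · exact Or.inr hu

end

section
variable {X : Type w} [Coord M X] {p : (X × M → Prop) → Prop}

/-- projection of a type -/
def projTy (p : (X × M → Prop) → Prop) : (X → Prop) → Prop := fun P => p (fun z => P z.1)

theorem IsTy.fib {P : X → Prop} (h : DU (fun z : X × M => P z.1)) : DU P := by
  obtain ⟨m⟩ := ‹Nonempty M›
  have : DU (fun x : X => (x, m)) := by fun_prop
  exact h.comp this

theorem IsTy.proj (hp : IsTy L p (M := M)) : IsTy L (M := M) (projTy p) where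
  df h := IsTy.fib (hp.df h)
  ne := hp.ne
  and h h' := hp.and h h'
  mono h hQ hi := hp.mono h (by fun_prop) fun x => hi x.1
  tot h := hp.tot (by fun_prop)

theorem DefTy.proj (hp : DefTy L A p) : DefTy L A (projTy p) := by
  intro U _ D hD
  exact hp (fun u z => D u z.1) (by fun_prop)

theorem Fwd.chain (IH : Fwd L X (M := M)) (hp : IsTy L p (M := M)) (hd : DefTy L A p) {U : Type w} [Coord M U]
    {Ω : U → Prop} {S : U → X × M → Prop} (hΩ : DF L A Ω) (hS : DF L A (fun q : U × (X × M) => S q.1 q.2))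
    (hSp : ∀ u, Ω u → p (S u))
    (hch : ∀ u v x, (∀ t, S u (x, t) → S v (x, t)) ∨ (∀ t, S v (x, t) → S u (x, t))) :
    FwdC L A p Ω S := by
  by_cases hne : ∃ u, Ω u
  swap
  · exact FwdC.triv hp fun u hu => absurd ⟨u, hu⟩ hne
  let B : U × U → X → Prop := fun uv x => ∀ t, S uv.1 (x, t) → S uv.2 (x, t)
  have hB : DF L A (fun q : (U × U) × X => B q.1 q.2) := by fun_prop
  have hqB := hd.proj B hB
  obtain ⟨V, _, O, 𝓑, h1, h2, h3⟩ := IH A (projTy p) hp.proj hd.proj (U × U)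
    (fun uv => Ω uv.1 ∧ Ω uv.2 ∧ projTy p (B uv)) B (by fun_prop) hB (fun u hu => hu.2.2)
  have d1 := h1.dfΩ
  have d2 := h1.dfD
  obtain ⟨u0, hu0⟩ := hne
  obtain ⟨w0, hw0⟩ := h1.ne
  have key : ∀ w u w' u', O w → Ω u → O w' → Ω u' → projTy p (B (u, u')) → ∃ w'', O w'' ∧ ∀ z : X × M,
      𝓑 w'' z.1 ∧ S u z → (𝓑 w z.1 ∧ S u z) ∧ (𝓑 w' z.1 ∧ S u' z) := by
    intro w u w' u' hw hu hw' hu' hb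
    obtain ⟨w1, hw1, hw1'⟩ := h3 (u, u') ⟨hu, hu', hb⟩
    obtain ⟨w2, hw2, hw2'⟩ := h1.dir w w' hw hw'
    obtain ⟨w3, hw3, hw3'⟩ := h1.dir w1 w2 hw1 hw2
    refine ⟨w3, hw3, ?_⟩
    rintro ⟨x, t⟩ ⟨k1, k2⟩
    obtain ⟨k3, k4⟩ := hw3' x k1
    obtain ⟨k5, k6⟩ := hw2' x k4
    exact ⟨⟨k5, k2⟩, k6, hw1' x k3 t k2⟩
  refine ⟨V × U, inferInstance, fun v => O v.1 ∧ Ω v.2, fun v z => 𝓑 v.1 z.1 ∧ S v.2 z,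
    ⟨by fun_prop, by fun_prop, ⟨(w0, u0), hw0, hu0⟩, ?_⟩, ?_, ?_⟩
  · rintro ⟨w, u⟩ ⟨w', u'⟩ ⟨hw, hu⟩ ⟨hw', hu'⟩
    rcases hp.proj.tot (P := B (u, u')) ((hB.mono (subset_univ _)).comp (DF.prodMk (DF.const _) DF.id)) with hb | hb
    · obtain ⟨w'', k1, k2⟩ := key w u w' u' hw hu hw' hu' hb
      exact ⟨(w'', u), ⟨k1, hu⟩, fun z hz => k2 z hz⟩
    · have hb' : projTy p (B (u', u)) := hp.proj.mono hb
        ((hB.mono (subset_univ _)).comp (DF.prodMk (DF.const _) DF.id)) fun x hx => (hch u u' x).resolve_left hx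
      obtain ⟨w'', k1, k2⟩ := key w' u' w u hw' hu' hw hu hb'
      exact ⟨(w'', u'), ⟨k1, hu'⟩, fun z hz => ⟨(k2 z hz).2, (k2 z hz).1⟩⟩
  · rintro ⟨w, u⟩ ⟨hw, hu⟩
    exact hp.and (h2 w hw) (hSp u hu)
  · intro u hu
    exact ⟨(w0, u), ⟨hw0, hu⟩, fun z hz => hz.2⟩

theorem Fwd.convex (IH : Fwd L X (M := M)) (hp : IsTy L p (M := M)) (hd : DefTy L A p) {U : Type w} [Coord M U]
    {Ω : U → Prop} {S : U → X × M → Prop} (hΩ : DF L A Ω) (hS : DF L A (fun q : U × (X × M) => S q.1 q.2))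
    (hSp : ∀ u, Ω u → p (S u))
    (hc : ∀ u x t s t', t ≤ s → s ≤ t' → S u (x, t) → S u (x, t') → S u (x, s)) :
    FwdC L A p Ω S := by
  have hS' := hS.mono (subset_univ _)
  have c1 : FwdC L A p Ω (fun u z => ∃ s, s ≤ z.2 ∧ S u (z.1, s)) := by
    refine Fwd.chain IH hp hd hΩ (by fun_prop) (fun u hu => hp.mono (hSp u hu) (by fun_prop)
      fun z hz => ⟨z.2, le_rfl, hz⟩) ?_
    intro u v x
    by_contra hno
    push Not at hno
    obtain ⟨⟨t, ⟨s, k1, k2⟩, k3⟩, t', ⟨s', k4, k5⟩, k6⟩ := hno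
    rcases le_total t t' with hle | hle
    · exact k6 s (k1.trans hle) k2
    · exact k3 s' (k4.trans hle) k5
  have c2 : FwdC L A p Ω (fun u z => ∃ s, z.2 ≤ s ∧ S u (z.1, s)) := by
    refine Fwd.chain IH hp hd hΩ (by fun_prop) (fun u hu => hp.mono (hSp u hu) (by fun_prop)
      fun z hz => ⟨z.2, le_rfl, hz⟩) ?_
    intro u v x
    by_contra hno
    push Not at hno
    obtain ⟨⟨t, ⟨s, k1, k2⟩, k3⟩, t', ⟨s', k4, k5⟩, k6⟩ := hno
    rcases le_total t t' with hle | hle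
    · exact k3 s' (hle.trans k4) k5
    · exact k6 s (hle.trans k1) k2
  obtain ⟨V, i, O, D, h1, h2, -, -, h3⟩ := c1.combine hp c2
  refine ⟨V, i, O, D, h1, h2, fun u hu => ?_⟩
  obtain ⟨v, hv, hvx⟩ := h3 u u hu hu
  refine ⟨v, hv, ?_⟩
  rintro ⟨x, t⟩ hx
  obtain ⟨⟨s, k1, k2⟩, s', k3, k4⟩ := hvx _ hx
  exact hc u x s t s' k1 k3 k2 k4

theorem Fwd.step (IH : Fwd L X (M := M)) : Fwd L (X × M) (M := M) := by
  intro A p hp hd U _ Ω S hΩ hS hSp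
  have hS' := hS.mono (subset_univ _)
  obtain ⟨K, hK⟩ := rk_exists (L := L) (X := U × X) (P := fun ux t => S ux.1 (ux.2, t)) (by fun_prop)
  let R : ℕ → U → X × M → Prop := fun j u z => rkEq (fun t => S u (z.1, t)) j z.2
  have hR : ∀ j, DF L A (fun q : U × (X × M) => R j q.1 q.2) := fun j =>
    DF.rkEq (X := U × X × M) (P := fun q t => S q.1 (q.2.1, t)) j (by fun_prop) (by fun_prop)
  have hR' := fun j => (hR j).mono (subset_univ _)
  have hfix : ∀ u x, DU (fun t => S u (x, t)) := fun u x => by fun_prop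
  have hj : ∀ j, FwdC L A p (fun u => Ω u ∧ p (R j u)) S := by
    intro j
    have d1 : DF L A (fun u => p (R j u)) := hd _ (hR j)
    have d2 := hR j
    refine (Fwd.convex IH hp hd (Ω := fun u => Ω u ∧ p (R j u)) (S := fun u z => S u z ∧ R j u z)
      (hΩ.and d1) (hS.and d2) (fun u hu => hp.and (hSp u hu.1) hu.2) ?_).mono (fun u hu => hu) ?_
    · rintro u x t s t' h1 h2 ⟨k1, k2⟩ ⟨k3, k4⟩
      obtain ⟨i, -, hi⟩ := hK (u, x) s
      have e1 := rk_le (L := L) (hfix u x) k2 hi h1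
      have e2 := rk_le (L := L) (hfix u x) hi k4 h2
      have e : i = j := le_antisymm e2 e1
      subst e
      exact ⟨(rk_const (L := L) (hfix u x) k2 hi).1 k1, hi⟩
    · exact fun u hu x hx => hx.1
  refine (FwdC.fin hp hj K).mono ?_ fun _ _ _ h => h
  intro u hu
  obtain ⟨j, hj, hpj⟩ := hp.exfin (P := fun j => R j u) (fun j => by have := hR' j; fun_prop) (hSp u hu) K
    (fun z _ => hK (u, z.1) z.2)
  exact ⟨j, hj, hu, hpj⟩
end

theorem Fwd.all (X : Type w) [Coord M X] : Fwd L X (M := M) := by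
  refine coord_induct (L := L) (M := M) (fun X _ => Fwd L X (M := M)) ?_ ?_ ?_ X
  · intro A p hp hd U _ Ω S hΩ hS hSp
    refine FwdC.triv hp fun u hu x => ?_
    by_contra hx
    exact hp.ne (hp.mono (hSp u hu) (by fun_prop) fun y hy => hx hy)
  · intro X _ h; exact h.step
  · intro X Y _ _ f g hgf hfg hf hg h A p hp hd U _ Ω S hΩ hS hSp
    have hf' := hf.mono (empty_subset A)
    have hg' := hg.mono (empty_subset A)
    have hf'' := hf.mono (empty_subset univ)
    have hg'' := hg.mono (empty_subset univ)
    obtain ⟨V, i, O, D, h1, h2, h3⟩ := h A (fun P => p (fun y => P (g y)))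
      { df := fun {P} hP => by
          have := (hp.df hP).comp hf''
          simpa only [hgf] using this
        ne := hp.ne
        and := fun h h' => hp.and h h'
        mono := fun h hQ hi => hp.mono h (by fun_prop) fun y => hi (g y)
        tot := fun h => hp.tot (by fun_prop) }
      (by
        intro U _ D hD
        exact hd (fun u y => D u (g y)) (by fun_prop))
      U Ω (fun u x => S u (f x)) hΩ (by fun_prop) (fun u hu => by simpa only [hfg] using hSp u hu)
    have d1 := h1.dfΩ
    have d2 := h1.dfD
    refine ⟨V, i, O, fun v y => D v (g y), ⟨d1, by fun_prop, h1.ne, fun v v' hv hv' => ?_⟩, h2, fun u hu => ?_⟩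
    · obtain ⟨w, hw, hwx⟩ := h1.dir v v' hv hv'
      exact ⟨w, hw, fun y hy => hwx _ hy⟩
    · obtain ⟨v, hv, hvx⟩ := h3 u hu
      exact ⟨v, hv, fun y hy => by simpa only [hfg] using hvx _ hy⟩
end

section
variable {L : FirstOrder.Language.{u, v}} {M : Type w} [L.Structure M] {A : Set M}
variable [LinearOrder M] [OMin L M]
variable [DenselyOrdered M] [NoMinOrder M] [NoMaxOrder M] [Nonempty M]

local notation "DU" => DF L (Set.univ : Set M)

variable (L) in
/-- backward statement -/
def Bwd (X : Type w) [Coord M X] : Prop :=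
  ∀ (A : Set M) (V : Type w) [Coord M V] (Ω : V → Prop) (D : V → X → Prop), Dir L A Ω D →
    (∀ v, Ω v → ∃ x, D v x) → ∃ p : (X → Prop) → Prop, IsTy L (M := M) p ∧ DefTy L A p ∧ ∀ v, Ω v → p (D v)

/-- `Z` holds eventually in the fibre of `D`. -/
def Ev {X : Type w} (D Z : X × M → Prop) (x : X) : Prop :=
  ∃ s, D (x, s) ∧ ∀ t, D (x, t) → s ≤ t → Z (x, t)

theorem Ev.and {X : Type w} {D Z Z' : X × M → Prop} {x : X} (h : Ev D Z x) (h' : Ev D Z' x) :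
    Ev D (fun z => Z z ∧ Z' z) x := by
  obtain ⟨s, h1, h2⟩ := h
  obtain ⟨s', h1', h2'⟩ := h'
  rcases le_total s s' with hle | hle
  · exact ⟨s', h1', fun t ht hst => ⟨h2 t ht (hle.trans hst), h2' t ht hst⟩⟩
  · exact ⟨s, h1, fun t ht hst => ⟨h2 t ht hst, h2' t ht (hle.trans hst)⟩⟩

theorem Ev.mono {X : Type w} {D Z Z' : X × M → Prop} {x : X} (h : Ev D Z x) (h' : ∀ t, Z (x, t) → Z' (x, t)) :
    Ev D Z' x := by
  obtain ⟨s, h1, h2⟩ := h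
  exact ⟨s, h1, fun t ht hst => h' t (h2 t ht hst)⟩

theorem Ev.exfin {X : Type w} [Coord M X] {D : X × M → Prop} {Z : ℕ → X × M → Prop} (hZ : ∀ j, DU (Z j)) {x : X}
    (hD : ∃ t, D (x, t)) (K : ℕ) {Q : X × M → Prop} (hQ : Ev D Q x)
    (h : ∀ z, Q z → ∃ j, j < K ∧ Z j z) : ∃ j, j < K ∧ Ev D (Z j) x := by
  induction K generalizing Q with
  | zero =>
    obtain ⟨s, h1, h2⟩ := hQ
    obtain ⟨j, hj, -⟩ := h _ (h2 s h1 le_rfl)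
    omega
  | succ K ih =>
    have hz := hZ K
    obtain ⟨s, hs, h1 | h1⟩ := DF.eventually (L := L) (D := fun t => D (x, t)) (Z := fun t => Z K (x, t))
      (hz.comp (DF.prodMk (DF.const x) DF.id)) hD
    · exact ⟨K, by omega, s, hs, h1⟩
    · have e : Ev D (fun z => ¬ Z K z) x := ⟨s, hs, h1⟩
      obtain ⟨j, hj, hpj⟩ := ih (hQ.and e) (by
        rintro z ⟨hx, hx'⟩
        obtain ⟨j, hj, hj'⟩ := h z hx
        refine ⟨j, ?_, hj'⟩
        have : j ≠ K := by rintro rfl; exact hx' hj'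
        omega)
      exact ⟨j, by omega, hpj⟩

theorem IsTy.ex {X : Type w} [Coord M X] {p : (X → Prop) → Prop} (hp : IsTy L p (M := M)) {P : X → Prop} (h1 : p P) :
    ∃ x, P x := by
  by_contra hno
  push Not at hno
  exact hp.ne (hp.mono h1 (by fun_prop) fun x hx => hno x hx)

theorem Bwd.step {X : Type w} [Coord M X] (IH : Bwd L X (M := M)) : Bwd L (X × M) (M := M) := by
  intro A V _ Ω D hD hne
  have d1 := hD.dfΩ
  have d2 := hD.dfD
  have d2' := d2.mono (subset_univ _)
  obtain ⟨q, hq, hqd, hqD⟩ := IH A V Ω (fun v x => ∃ t, D v (x, t)) ⟨d1, by fun_prop, hD.ne, fun v v' hv hv' => by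
      obtain ⟨w, hw, hwx⟩ := hD.dir v v' hv hv'
      exact ⟨w, hw, fun x ⟨t, ht⟩ => ⟨⟨t, (hwx _ ht).1⟩, ⟨t, (hwx _ ht).2⟩⟩⟩⟩ (fun v hv => by
      obtain ⟨⟨x, t⟩, hx⟩ := hne v hv
      exact ⟨x, t, hx⟩)
  have hDv : ∀ v, DU (D v) := fun v => d2'.comp (DF.prodMk (DF.const v) DF.id)
  have hEv : ∀ v {Z : X × M → Prop}, DU Z → DU (Ev (D v) Z) := by
    intro v Z hZ
    have := hDv v
    unfold Ev
    fun_prop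
  refine ⟨fun Z => DU Z ∧ ∃ u, Ω u ∧ ∀ v, Ω v → (∀ z, D v z → D u z) → q (Ev (D v) Z), ?_, ?_, ?_⟩
  · constructor
    · exact fun h => h.1
    · rintro ⟨-, u, hu, h⟩
      obtain ⟨x, s, h1, h2⟩ := hq.ex (h u hu fun _ h => h)
      exact h2 s h1 le_rfl
    · rintro P Q ⟨h1, u, hu, h2⟩ ⟨h1', u', hu', h2'⟩
      obtain ⟨w, hw, hwx⟩ := hD.dir u u' hu hu'
      refine ⟨h1.and h1', w, hw, fun v hv hvw => ?_⟩
      exact hq.mono (hq.and (h2 v hv fun z hz => (hwx z (hvw z hz)).1) (h2' v hv fun z hz => (hwx z (hvw z hz)).2))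
        (hEv v (h1.and h1')) fun x hx => hx.1.and hx.2
    · rintro P Q ⟨h1, u, hu, h2⟩ hQ hPQ
      exact ⟨hQ, u, hu, fun v hv hvu => hq.mono (h2 v hv hvu) (hEv v hQ) fun x hx => hx.mono fun t => hPQ _⟩
    · intro Z hZ
      obtain ⟨K, hK⟩ := rk_exists (L := L) (X := X) (P := fun x t => Z (x, t)) (by fun_prop)
      let R : ℕ → X × M → Prop := fun j z => rkEq (fun t => Z (z.1, t)) j z.2
      have hR : ∀ j, DU (R j) := fun j =>
        DF.rkEq (X := X × M) (P := fun q t => Z (q.1, t)) j (by fun_prop) (by fun_prop)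
      have hfix : ∀ x, DU (fun t => Z (x, t)) := fun x => by fun_prop
      have hex : ∀ v, Ω v → ∃ j, q (Ev (D v) (R j)) := by
        intro v hv
        obtain ⟨j, -, hj⟩ := hq.exfin (P := fun j => Ev (D v) (R j)) (fun j => hEv v (hR j)) (hqD v hv) K (by
          rintro x ⟨t, ht⟩
          exact Ev.exfin (L := L) hR ⟨t, ht⟩ K (Q := fun _ => True) ⟨t, ht, fun _ _ _ => trivial⟩
            fun z _ => hK z.1 z.2)
        exact ⟨j, hj⟩
      have hex' : ∃ j, ∃ v, Ω v ∧ q (Ev (D v) (R j)) := by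
        obtain ⟨v, hv⟩ := hD.ne
        obtain ⟨j, hj⟩ := hex v hv
        exact ⟨j, v, hv, hj⟩
      classical
      obtain ⟨J, ⟨u, hu, huJ⟩, hmin⟩ : ∃ J, (∃ v, Ω v ∧ q (Ev (D v) (R J))) ∧
          ∀ j, (∃ v, Ω v ∧ q (Ev (D v) (R j))) → J ≤ j :=
        ⟨Nat.find hex', Nat.find_spec hex', fun j hj => Nat.find_min' hex' hj⟩
      have hall : ∀ v, Ω v → (∀ z, D v z → D u z) → q (Ev (D v) (R J)) := by
        intro v hv hvu
        obtain ⟨j, hj⟩ := hex v hv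
        have e1 := hmin j ⟨v, hv, hj⟩
        obtain ⟨x, ⟨s, h1, h2⟩, ⟨s', h1', h2'⟩⟩ := hq.ex (hq.and hj huJ)
        have e2 : j ≤ J := by
          refine rk_le (L := L) (hfix x) (t := s) (t' := max s s') (h2 s h1 le_rfl) ?_ (le_max_left _ _)
          rcases le_total s s' with hle | hle
          · rw [max_eq_right hle]; exact h2' s' h1' le_rfl
          · rw [max_eq_left hle]; exact h2' s (hvu _ h1) hle
        have : j = J := le_antisymm e2 e1
        subst this; exact hj
      let Zp : X → Prop := fun x => ∃ t, R J (x, t) ∧ Z (x, t)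
      have hZp : DU Zp := by
        have := hR J
        exact DF.ex (P := fun x t => R J (x, t) ∧ Z (x, t)) (DF.and this hZ)
      rcases hq.tot hZp with hz | hz
      · left
        refine ⟨hZ, u, hu, fun v hv hvu => ?_⟩
        refine hq.mono (hq.and (hall v hv hvu) hz) (hEv v hZ) ?_
        rintro x ⟨hx, t, ht, htZ⟩
        exact hx.mono fun t' ht' => (rk_const (L := L) (hfix x) ht ht').1 htZ
      · right
        refine ⟨hZ.not, u, hu, fun v hv hvu => ?_⟩
        refine hq.mono (hq.and (hall v hv hvu) hz) (hEv v hZ.not) ?_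
        rintro x ⟨hx, hx'⟩
        exact hx.mono fun t' ht' hc => hx' ⟨t', ht', hc⟩
  · intro W _ E hE
    have hE' := hE.mono (subset_univ _)
    have hEw : ∀ w, DU (E w) := fun w => hE'.comp (DF.prodMk (DF.const w) DF.id)
    simp only [hEw, true_and]
    obtain ⟨G, hG, hGe⟩ : ∃ G : W × V → Prop, DF L A G ∧ ∀ w v, q (Ev (D v) (E w)) ↔ G (w, v) :=
      ⟨fun wv => q (Ev (D wv.2) (E wv.1)), hqd (fun wv : W × V => Ev (D wv.2) (E wv.1)) (by unfold Ev; fun_prop),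
        fun _ _ => Iff.rfl⟩
    simp only [hGe]
    fun_prop
  · intro u hu
    refine ⟨hDv u, u, hu, fun v hv hvu => hq.mono (hqD v hv) (hEv v (hDv u)) ?_⟩
    rintro x ⟨t, ht⟩
    exact ⟨t, ht, fun t' ht' _ => hvu _ ht'⟩

theorem Bwd.all (X : Type w) [Coord M X] : Bwd L X (M := M) := by
  refine coord_induct (L := L) (M := M) (fun X _ => Bwd L X (M := M)) ?_ ?_ ?_ X
  · intro A V _ Ω D hD hne
    refine ⟨fun P => P ⟨⟩, ⟨?_, ?_, ?_, ?_, ?_⟩, ?_, ?_⟩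
    · intro P h
      have : P = fun _ => True := by funext x; exact eq_true h
      rw [this]; fun_prop
    · exact fun h => h
    · exact fun h h' => ⟨h, h'⟩
    · exact fun h _ h' => h' _ h
    · exact fun {P} _ => em _
    · intro U _ D hD
      have : DF L A (fun u : U => (u, PUnit.unit)) := 
        DF.coordMap (Y := U × PUnit) (Sum.elim id Empty.elim : Coord.ι M U ⊕ Empty → Coord.ι M U) (fun u => by
          funext i
          rcases i with i | i
          · rfl
          · exact Empty.elim i)
      exact hD.comp this
    · intro v hv
      obtain ⟨⟨⟩, hx⟩ := hne v hv
      exact hx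
  · intro X _ h; exact h.step
  · intro X Y _ _ f g hgf hfg hf hg h A V _ Ω D hD hne
    have hf' := hf.mono (empty_subset A)
    have hg' := hg.mono (empty_subset A)
    have hf'' := hf.mono (empty_subset univ)
    have hg'' := hg.mono (empty_subset univ)
    have d1 := hD.dfΩ
    have d2 := hD.dfD
    obtain ⟨p, hp, hd, hpD⟩ := h A V Ω (fun v x => D v (f x)) ⟨d1, by fun_prop, hD.ne, fun v v' hv hv' => by
        obtain ⟨w, hw, hwx⟩ := hD.dir v v' hv hv'
        exact ⟨w, hw, fun y hy => hwx _ hy⟩⟩ (fun v hv => by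
        obtain ⟨y, hy⟩ := hne v hv
        exact ⟨g y, by simpa only [hfg] using hy⟩)
    refine ⟨fun P => p (fun x => P (f x)),
      { df := fun {P} hP => by
          have := (hp.df hP).comp hg''
          simpa only [hfg] using this
        ne := hp.ne
        and := fun h h' => hp.and h h'
        mono := fun h hQ hi => hp.mono h (by fun_prop) fun y => hi (f y)
        tot := fun h => hp.tot (by fun_prop) }, ?_, hpD⟩
    intro U _ D hD
    exact hd (fun u y => D u (f y)) (by fun_prop)
end

section
variable {L : FirstOrder.Language.{u, v}} {M : Type w} [L.Structure M] {A : Set M}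

theorem DF.coordMapC {X Y : Type*} [Coord M X] [Coord M Y] {f : X → Y}
    (h : ∀ i : Coord.ι M Y, (∃ j : Coord.ι M X, ∀ x, (Coord.e (f x) : Coord.ι M Y → M) i = Coord.e x j) ∨
      ∃ a ∈ A, ∀ x, (Coord.e (f x) : Coord.ι M Y → M) i = a) : DF L A f := by
  have h1 : A.Definable L (⋂ i : Coord.ι M Y, {v : Coord.ι M X ⊕ Coord.ι M Y → M |
      v (Sum.inr i) = (Coord.e (f (Coord.e.symm (v ∘ Sum.inl))) : Coord.ι M Y → M) i}) := by
    refine definable_iInter_of_finite fun i => ?_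
    rcases h i with ⟨j, hj⟩ | ⟨a, ha, hj⟩
    · simp only [hj, Equiv.apply_symm_apply]
      exact definable_eq_coord _ _
    · simp only [hj]
      refine ⟨((FirstOrder.Language.var (Sum.inr i)).equal
        (FirstOrder.Language.Constants.term ((L.con (⟨a, ha⟩ : A))))), ?_⟩
      ext x; simp
  unfold DF
  refine (congrArg (A.Definable L) (Set.ext fun v => ?_)).mp h1
  change _ ↔ v ∘ Sum.inr = Coord.e (f (Coord.e.symm (v ∘ Sum.inl)))
  rw [mem_iInter, funext_iff]
  rfl

theorem famOfDF {n : ℕ} {V : Type w} [Coord M V] {Ω : V → Prop} {D : V → (Fin n → M) → Prop} (hΩ : DF L A Ω)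
    (hD : DF L A (fun q : V × (Fin n → M) => D q.1 q.2)) :
    IsDefFamily L A n ((fun v => {x | D v x}) '' {v | Ω v}) := by
  obtain ⟨m, ⟨σ⟩⟩ := Finite.exists_equiv_fin (Coord.ι M V)
  rw [DF.prop_iff] at hΩ hD
  refine ⟨m, _, _, hΩ.preimage_comp σ, hD.preimage_comp (Sum.map σ (id : Fin n → Fin n)), ?_⟩
  ext S
  constructor
  · rintro ⟨v, hv, rfl⟩
    have e : Coord.e.symm ((Coord.e v ∘ σ.symm) ∘ σ) = v := by
      rw [Function.comp_assoc, Equiv.symm_comp_self, Function.comp_id, Equiv.symm_apply_apply]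
    refine ⟨Coord.e v ∘ σ.symm, ?_, ?_⟩
    · change Ω (Coord.e.symm ((Coord.e v ∘ σ.symm) ∘ σ))
      rw [e]; exact hv
    · ext x
      change D (Coord.e.symm ((Coord.e v ∘ σ.symm) ∘ σ)) x ↔ D v x
      rw [e]
  · rintro ⟨u, hu, rfl⟩
    exact ⟨Coord.e.symm (u ∘ σ), hu, rfl⟩

theorem DF.ofFam {m n : ℕ} {D : Set (Fin m ⊕ Fin n → M)} (h : A.Definable L D) :
    DF L A (fun q : (Fin m → M) × (Fin n → M) => Sum.elim q.1 q.2 ∈ D) := by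
  rw [DF.prop_iff]
  refine (congrArg (A.Definable L) (Set.ext fun v => ?_)).mp h
  change _ ↔ Sum.elim (v ∘ Sum.inl) (v ∘ Sum.inr) ∈ D
  rw [Sum.elim_comp_inl_inr]

theorem DF.ofSet {m : ℕ} {D : Set (Fin m → M)} : DF L A (fun x => x ∈ D) ↔ A.Definable L D := by
  rw [DF.prop_iff]; rfl

theorem defTy_of {n : ℕ} {p : Set (Set (Fin n → M))} (h : IsDefTypeOver L A n p) :
    DefTy L A (fun P : (Fin n → M) → Prop => {x | P x} ∈ p) := by
  intro U _ D hD
  rw [DF.prop_iff, definable_iff_finitely_definable] at hD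
  obtain ⟨A0, hA0, hD⟩ := hD
  rw [definable_iff_exists_formula_sum] at hD
  obtain ⟨φ, hφ⟩ := hD
  obtain ⟨m, ⟨σ⟩⟩ := Finite.exists_equiv_fin ((A0 : Set M) ⊕ Coord.ι M U)
  let τ : (A0 : Set M) ⊕ (Coord.ι M U ⊕ Fin n) → Fin m ⊕ Fin n :=
    Sum.elim (fun a => Sum.inl (σ (Sum.inl a))) (Sum.elim (fun i => Sum.inl (σ (Sum.inr i))) Sum.inr)
  have h0 : (∅ : Set M).Definable L {v : Fin m ⊕ Fin n → M | φ.Realize (v ∘ τ)} := by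
    rw [empty_definable_iff]
    exact ⟨φ.relabel τ, by ext v; simp [FirstOrder.Language.Formula.realize_relabel]⟩
  have h1 := DF.ofSet.2 (h m _ h0)
  have h2 : DF L A (fun u : U => fun i : Fin m =>
      (Sum.elim (fun a : (A0 : Set M) => (a : M)) (Coord.e u) (σ.symm i) : M)) := by
    refine DF.coordMapC fun i => ?_
    rcases hi : σ.symm i with a | j
    · exact Or.inr ⟨a, hA0 a.2, fun x => by
        change Sum.elim _ _ (σ.symm i) = _
        rw [hi]; rfl⟩
    · exact Or.inl ⟨j, fun x => by
        change Sum.elim _ _ (σ.symm i) = _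
        rw [hi]; rfl⟩
  have h3 := h1.comp h2
  refine (congrArg (DF L A) (funext fun u => ?_)).mp h3
  change (_ ∈ p) = (_ ∈ p)
  congr 1
  ext x
  have h4 : (Sum.elim (Coord.e u) x : Coord.ι M U ⊕ Fin n → M) ∈
      {v : Coord.ι M U ⊕ Fin n → M | D (Coord.e.symm (v ∘ Sum.inl)) (v ∘ Sum.inr)} ↔ D u x := by
    change D (Coord.e.symm (Coord.e u)) x ↔ _
    rw [Equiv.symm_apply_apply]
  have h5 : (Sum.elim (Coord.e u) x : Coord.ι M U ⊕ Fin n → M) ∈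
      {v : Coord.ι M U ⊕ Fin n → M | D (Coord.e.symm (v ∘ Sum.inl)) (v ∘ Sum.inr)} ↔
      φ.Realize (Sum.elim (fun a : (A0 : Set M) => (a : M)) (Sum.elim (Coord.e u) x)) := by
    have := Set.ext_iff.1 hφ (Sum.elim (Coord.e u) x)
    exact this
  refine Iff.trans ?_ (h5.symm.trans h4)
  change φ.Realize (Sum.elim _ x ∘ τ) ↔ _
  refine iff_of_eq (congrArg _ ?_)
  funext i
  rcases i with a | i | i
  · change Sum.elim _ _ (σ.symm (σ _)) = _
    rw [Equiv.symm_apply_apply]; rfl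
  · change Sum.elim _ _ (σ.symm (σ _)) = _
    rw [Equiv.symm_apply_apply]; rfl
  · rfl

theorem isTy_of {n : ℕ} {p : Set (Set (Fin n → M))} (h : IsTypeOn L n p) :
    IsTy L (M := M) (fun P : (Fin n → M) → Prop => {x | P x} ∈ p) := by
  obtain ⟨h1, h2, h3, h4, h5⟩ := h
  exact
    { df := fun {P} hP => DF.ofSet.2 (h1 _ hP)
      ne := h2
      and := fun hP hQ => h3 _ hP _ hQ
      mono := fun hP hQ hPQ => h4 _ hP _ (DF.ofSet.1 hQ) hPQ
      tot := fun hP => h5 _ (DF.ofSet.1 hP) }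

theorem typeOn_of {n : ℕ} {p : ((Fin n → M) → Prop) → Prop} (h : IsTy L (M := M) p) :
    IsTypeOn L n {X : Set (Fin n → M) | p (fun x => x ∈ X)} :=
  ⟨fun X hX => DF.ofSet.1 (h.df hX), h.ne, fun X hX Y hY => h.and hX hY,
    fun X hX Y hY hXY => h.mono hX (DF.ofSet.2 hY) hXY, fun X hX => h.tot (DF.ofSet.2 hX)⟩

theorem defTypeOver_of {n : ℕ} {p : ((Fin n → M) → Prop) → Prop} (h : DefTy L A p) :
    IsDefTypeOver L A n {X : Set (Fin n → M) | p (fun x => x ∈ X)} := by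
  intro m D hD
  exact DF.ofSet.1 (h (fun u x => Sum.elim u x ∈ D) (DF.ofFam (hD.mono (empty_subset A))))

end

/-- parameter version. An `A`-definable family `S` extends to an `A`-definable
`n`-type if and only if there is an `A`-definable downward directed family finer than `S`. -/
theorem statement1 (L : FirstOrder.Language) (M : Type*) [L.Structure M] [LinearOrder M]
    (hM : IsOMinimal L M) (A : Set M) (n : ℕ) (S : Set (Set (Fin n → M)))
    (hS : IsDefFamily L A n S) :
    (∃ p, IsTypeOn L n p ∧ IsDefTypeOver L A n p ∧ S ⊆ p) ↔
      (∃ D, IsDefFamily L A n D ∧ DirectedFam D ∧ FinerThan D S) := by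
  have : OMin L M := ⟨hM⟩
  have := hM.1
  have := hM.2.1
  have := hM.2.2.1
  have := hM.2.2.2.1
  obtain ⟨m, Ω, E, hΩ, hE, rfl⟩ := hS
  have hE' := DF.ofFam hE
  constructor
  · rintro ⟨p, hp, hpd, hpS⟩
    obtain ⟨V, i, O, D, h1, h2, h3⟩ := Fwd.all (L := L) (M := M) (Fin n → M) A _ (isTy_of hp) (defTy_of hpd)
      (Fin m → M) (fun u => u ∈ Ω) (fun u x => Sum.elim u x ∈ E) (DF.ofSet.2 hΩ) hE'
      (fun u hu => hpS ⟨u, hu, rfl⟩)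
    refine ⟨_, famOfDF h1.dfΩ h1.dfD, ⟨?_, ?_⟩, ?_⟩
    · rintro ⟨v, hv, hv'⟩
      have h4 : {x | D v x} ∈ p := h2 v hv
      rw [show {x | D v x} = ∅ from hv'] at h4
      exact hp.2.1 h4
    · rintro _ ⟨v, hv, rfl⟩ _ ⟨v', hv', rfl⟩
      obtain ⟨w, hw, hwx⟩ := h1.dir v v' hv hv'
      exact ⟨_, ⟨w, hw, rfl⟩, fun x hx => hwx x hx⟩
    · rintro _ ⟨u, hu, rfl⟩
      obtain ⟨v, hv, hvx⟩ := h3 u hu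
      exact ⟨_, ⟨v, hv, rfl⟩, hvx⟩
  · rintro ⟨_, ⟨k, Ω', D, hΩ', hD, rfl⟩, ⟨hne, hdir⟩, hfin⟩
    obtain ⟨p, hp, hpd, hpm⟩ : ∃ p : ((Fin n → M) → Prop) → Prop, IsTy L (M := M) p ∧ DefTy L A p ∧
        ∀ v ∈ Ω', p (fun x => Sum.elim v x ∈ D) := by
      by_cases hO : ∃ v, v ∈ Ω'
      · refine Bwd.all (L := L) (M := M) (Fin n → M) A (Fin k → M) (fun v => v ∈ Ω')
          (fun v x => Sum.elim v x ∈ D) ⟨DF.ofSet.2 hΩ', DF.ofFam hD, hO, ?_⟩ ?_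
        · intro v v' hv hv'
          obtain ⟨_, ⟨w, hw, rfl⟩, hwx⟩ := hdir _ ⟨v, hv, rfl⟩ _ ⟨v', hv', rfl⟩
          exact ⟨w, hw, fun x hx => hwx hx⟩
        · intro v hv
          by_contra hno
          push Not at hno
          exact hne ⟨v, hv, Set.eq_empty_iff_forall_notMem.2 hno⟩
      · obtain ⟨p, hp, hpd, -⟩ := Bwd.all (L := L) (M := M) (Fin n → M) A PUnit (fun _ => True)
          (fun _ _ => True) ⟨DF.constProp _, DF.constProp _, ⟨⟨⟩, trivial⟩,
            fun _ _ _ _ => ⟨⟨⟩, trivial, fun _ _ => ⟨trivial, trivial⟩⟩⟩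
          (fun _ _ => ⟨fun _ => Classical.arbitrary M, trivial⟩)
        exact ⟨p, hp, hpd, fun v hv => absurd ⟨v, hv⟩ hO⟩
    refine ⟨_, typeOn_of hp, defTypeOver_of hpd, ?_⟩
    rintro _ ⟨u, hu, rfl⟩
    obtain ⟨_, ⟨v, hv, rfl⟩, hvx⟩ := hfin _ ⟨u, hu, rfl⟩
    exact hp.mono (hpm v hv) ((hE'.mono (subset_univ _)).comp (DF.prodMk (DF.const u) DF.id)) fun x hx => hvx hx
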